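/- Let N ≥ 2, let α ∈ (0,1) and β ∈ (α,1). Suppose E ⊆ ℝ^N is a nonempty bounded open set whose boundary is of class C^{2,β}, and suppose there is a constant c ∈ ℝ such that for every x ∈ ∂E the principal-value limit H_E(x) = −lim_{ε→0} ∫_{{y : |y−x| ≥ ε}} τ_E(y) |x−y|^{−(N+α)} dy exists and equals c. Then E is a ball, i.e. there exist z ∈ ℝ^N and r > 0 such that E is the open Euclidean ball of radius r centered at z. -/

import Mathlib

open MeasureTheory Filter Topology Classical

/-- `τ_E = 1_E − 1_{E^c}`: the function equal to `1` on `E` and `−1` on its complement. -/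
noncomputable def tauE {N : ℕ} (E : Set (EuclideanSpace ℝ (Fin N)))
    (y : EuclideanSpace ℝ (Fin N)) : ℝ :=
  if y ∈ E then 1 else -1

/-- The point of `ℝ^N` with first `N−1` coordinates given by `y` and last coordinate `t`. -/
noncomputable def graphPt (N : ℕ) (y : EuclideanSpace ℝ (Fin (N - 1))) (t : ℝ) :
    EuclideanSpace ℝ (Fin N) :=
  (EuclideanSpace.equiv (Fin N) ℝ).symm (fun i => if h : (i : ℕ) < N - 1 then y ⟨i, h⟩ else t)

/-- A bounded open set `E ⊆ ℝ^N` has boundary of class `C^{2,β}`: near each boundary point `x`,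
after a rigid motion `y ↦ x + A y` (with `A` a linear isometry), `E` is the subgraph and `∂E` the
graph of a `C²` function `h` with `β`-Hölder second derivatives, `h 0 = 0`, `∇h(0) = 0`. -/
def HasC2HolderBoundary {N : ℕ} (E : Set (EuclideanSpace ℝ (Fin N))) (β : ℝ) : Prop :=
  ∀ x ∈ frontier E,
    ∃ (r : ℝ) (A : EuclideanSpace ℝ (Fin N) ≃ₗᵢ[ℝ] EuclideanSpace ℝ (Fin N))
      (h : EuclideanSpace ℝ (Fin (N - 1)) → ℝ) (M : ℝ),
      0 < r ∧ ContDiff ℝ 2 h ∧ h 0 = 0 ∧ fderiv ℝ h 0 = 0 ∧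
      (∀ y z, ‖iteratedFDeriv ℝ 2 h y - iteratedFDeriv ℝ 2 h z‖ ≤ M * ‖y - z‖ ^ β) ∧
      (∀ (y : EuclideanSpace ℝ (Fin (N - 1))) (t : ℝ), ‖y‖ < r → |t| < r →
        ((x + A (graphPt N y t) ∈ E ↔ t < h y) ∧
         (x + A (graphPt N y t) ∈ frontier E ↔ t = h y)))



abbrev VV (N : ℕ) := EuclideanSpace ℝ (Fin N)

noncomputable def Rl {N : ℕ} (e : VV N) : VV N ≃ₗᵢ[ℝ] VV N := (Submodule.span ℝ {e})ᗮ.reflection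

lemma Rl_apply {N : ℕ} {e : VV N} (he : ‖e‖ = 1) (x : VV N) :
    Rl e x = x - (2 * inner ℝ x e) • e := by
  unfold Rl
  rw [Submodule.reflection_orthogonal_apply, Submodule.reflection_singleton_apply, he]
  rw [real_inner_comm]
  simp only [smul_smul, two_smul, RCLike.ofReal_real_eq_id, id, one_pow, div_one]
  module

noncomputable def rf {N : ℕ} (e : VV N) (l : ℝ) (x : VV N) : VV N := Rl e x + (2 * l) • e

lemma rf_apply {N : ℕ} {e : VV N} (he : ‖e‖ = 1) (l : ℝ) (x : VV N) :
    rf e l x = x - (2 * (inner ℝ x e - l)) • e := by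
  unfold rf; rw [Rl_apply he]; module

lemma inner_ee {N : ℕ} {e : VV N} (he : ‖e‖ = 1) : inner ℝ e e = 1 := by
  rw [real_inner_self_eq_norm_sq, he]; norm_num

lemma rf_inner {N : ℕ} {e : VV N} (he : ‖e‖ = 1) (l : ℝ) (x : VV N) :
    inner ℝ (rf e l x) e = 2 * l - inner ℝ x e := by
  rw [rf_apply he, inner_sub_left, inner_smul_left, inner_ee he]; simp; ring

lemma rf_rf {N : ℕ} {e : VV N} (he : ‖e‖ = 1) (l : ℝ) (x : VV N) :
    rf e l (rf e l x) = x := by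
  rw [rf_apply he l (rf e l x), rf_inner he, rf_apply he]; module

lemma rf_add {N : ℕ} (e : VV N) (l : ℝ) (x w : VV N) :
    rf e l (x + w) = rf e l x + Rl e w := by
  unfold rf; rw [map_add]; abel

lemma rf_cont {N : ℕ} (e : VV N) (l : ℝ) : Continuous (rf e l) := by
  unfold rf; fun_prop

lemma rf_mp {N : ℕ} (e : VV N) (l : ℝ) : MeasurePreserving (rf e l) := by
  have h1 := (Rl e).measurePreserving
  have h2 := measurePreserving_add_right (volume : Measure (VV N)) ((2*l) • e)
  exact h2.comp h1

noncomputable def rfH {N : ℕ} {e : VV N} (he : ‖e‖ = 1) (l : ℝ) : VV N ≃ₜ VV N where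
  toFun := rf e l
  invFun := rf e l
  left_inv := rf_rf he l
  right_inv := rf_rf he l
  continuous_toFun := rf_cont e l
  continuous_invFun := rf_cont e l

lemma rf_me {N : ℕ} {e : VV N} (he : ‖e‖ = 1) (l : ℝ) : MeasurableEmbedding (rf e l) :=
  (rfH he l).measurableEmbedding

lemma rf_dist {N : ℕ} {e : VV N} (he : ‖e‖ = 1) (l : ℝ) (x y : VV N) :
    ‖rf e l y - x‖ ^ 2 - ‖y - x‖ ^ 2 = 4 * (inner ℝ y e - l) * (inner ℝ x e - l) := by
  rw [rf_apply he]
  have : y - (2 * (inner ℝ y e - l)) • e - x = (y - x) - (2 * (inner ℝ y e - l)) • e := by abel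
  rw [this, norm_sub_sq_real, norm_smul, he, inner_smul_right, inner_sub_left, mul_one,
    Real.norm_eq_abs, sq_abs]
  ring

noncomputable def tau {N : ℕ} (E : Set (VV N)) (y : VV N) : ℝ := if y ∈ E then 1 else -1

lemma tau_abs {N : ℕ} (E : Set (VV N)) (y : VV N) : |tau E y| = 1 := by
  unfold tau; split_ifs <;> simp

lemma tau_meas {N : ℕ} {E : Set (VV N)} (hE : MeasurableSet E) : Measurable (tau E) := by
  unfold tau; exact Measurable.ite hE measurable_const measurable_const

lemma tau_le {N : ℕ} {E : Set (VV N)} {x y : VV N} (h : x ∈ E → y ∈ E) : tau E x ≤ tau E y := by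
  unfold tau; split_ifs <;> simp_all <;> norm_num

/-- truncated kernel -/
noncomputable def ks {N : ℕ} (p s : ℝ) (w : VV N) : ℝ := (max ‖w‖ s) ^ (-p)

lemma ks_nonneg {N : ℕ} {p s : ℝ} (hs : 0 < s) (w : VV N) : 0 ≤ ks p s w := by
  unfold ks; positivity

lemma ks_cont {N : ℕ} {p s : ℝ} (hs : 0 < s) : Continuous (ks p s : VV N → ℝ) := by
  unfold ks
  refine Continuous.rpow_const (by fun_prop) fun w => Or.inl ?_
  have : 0 < max ‖w‖ s := lt_max_of_lt_right hs
  exact this.ne'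

lemma ks_integrable {N : ℕ} {p s : ℝ} (hp : (N : ℝ) < p) (hs : 0 < s) :
    Integrable (ks p s : VV N → ℝ) := by
  have h1 : Integrable (fun x : VV N => (1 + ‖x‖) ^ (-p)) := by
    apply integrable_one_add_norm; simpa using hp
  have hp0 : 0 < p := lt_of_le_of_lt (Nat.cast_nonneg N) hp
  set c := min 1 s / 2 with hc
  have hc0 : 0 < c := by positivity
  refine (h1.const_mul (c ^ (-p))).mono' (ks_cont hs).aestronglyMeasurable ?_
  refine ae_of_all _ fun w => ?_
  rw [Real.norm_of_nonneg (ks_nonneg hs w), ← Real.mul_rpow hc0.le (by positivity)]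
  unfold ks
  apply Real.rpow_le_rpow_of_nonpos (by positivity) _ (by linarith)
  have h2 : c ≤ s / 2 := by rw [hc]; gcongr; exact min_le_right _ _
  have h3 : c ≤ 1 / 2 := by rw [hc]; gcongr; exact min_le_left _ _
  have := le_max_left ‖w‖ s
  have := le_max_right ‖w‖ s
  nlinarith [norm_nonneg w]

lemma ks_le {N : ℕ} {p s : ℝ} (hp : 0 < p) (hs : 0 < s) {w : VV N} (hw : w ≠ 0) :
    ks p s w ≤ ‖w‖ ^ (-p) := by
  unfold ks
  exact Real.rpow_le_rpow_of_nonpos (by positivity) (le_max_left _ _) (by linarith)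

lemma ks_eq {N : ℕ} {p s : ℝ} {w : VV N} (hw : s ≤ ‖w‖) : ks p s w = ‖w‖ ^ (-p) := by
  unfold ks; rw [max_eq_left hw]

lemma ks_anti {N : ℕ} {p s : ℝ} (hp : 0 < p) (hs : 0 < s) {w v : VV N} (hw : ‖w‖ ≤ ‖v‖) :
    ks p s v ≤ ks p s w := by
  unfold ks
  exact Real.rpow_le_rpow_of_nonpos (by positivity) (max_le_max_right _ hw) (by linarith)

lemma ks_int {N : ℕ} {p s : ℝ} (hs : 0 < s) :
    ∫ w : VV N, ks p s w = s ^ ((N : ℝ) - p) * ∫ w : VV N, ks p 1 w := by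
  have h := Measure.integral_comp_inv_smul_of_nonneg (volume : Measure (VV N)) (ks p 1) hs.le
  have h2 : ∀ w : VV N, ks p s w = s ^ (-p) * ks p 1 (s⁻¹ • w) := by
    intro w
    unfold ks
    rw [← Real.mul_rpow hs.le (by positivity), mul_max_of_nonneg _ _ hs.le, norm_smul,
      Real.norm_of_nonneg (by positivity), mul_inv_cancel_left₀ hs.ne', mul_one]
  simp_rw [h2]
  rw [integral_const_mul, h]
  simp only [finrank_euclideanSpace, Fintype.card_fin, smul_eq_mul]
  rw [sub_eq_neg_add, Real.rpow_add hs, Real.rpow_natCast]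
  ring

lemma rpow_diff {p a b : ℝ} (hp : 0 < p) (ha : 0 < a) (hab : a ≤ b) :
    p * b ^ (-p - 1) * (b - a) ≤ a ^ (-p) - b ^ (-p) ∧
    a ^ (-p) - b ^ (-p) ≤ p * a ^ (-p - 1) * (b - a) := by
  rcases hab.eq_or_lt with rfl | hab
  · simp
  obtain ⟨c, hc, h⟩ := exists_deriv_eq_slope (fun x : ℝ => x ^ (-p)) hab
    (ContinuousOn.rpow_const continuousOn_id fun x hx => Or.inl (by simp at hx ⊢; linarith [hx.1]))
    (fun x hx => (Real.differentiableAt_rpow_const_of_ne _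
      (by linarith [hx.1] : x ≠ 0)).differentiableWithinAt)
  have hc0 : 0 < c := ha.trans hc.1
  rw [Real.deriv_rpow_const, eq_div_iff (by linarith)] at h
  have h1 : c ^ (-p - 1) ≤ a ^ (-p - 1) :=
    Real.rpow_le_rpow_of_nonpos ha hc.1.le (by linarith)
  have h2 : b ^ (-p - 1) ≤ c ^ (-p - 1) :=
    Real.rpow_le_rpow_of_nonpos hc0 hc.2.le (by linarith)
  have h3 : p * c ^ (-p - 1) * (b - a) = a ^ (-p) - b ^ (-p) := by linarith
  rw [← h3]
  constructor <;> gcongr <;> linarith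

lemma ks_shift {N : ℕ} {p s : ℝ} (hp : (N : ℝ) < p) (hs : 0 < s) {v : VV N} (hv : ‖v‖ ≤ s / 2) :
    ∫ w : VV N, |ks p s w - ks p s (w - v)| ≤
      (p * 2 ^ (p + 1) * ∫ w : VV N, ks p 1 w) * (‖v‖ / s) * s ^ ((N : ℝ) - p) := by
  have hp0 : 0 < p := lt_of_le_of_lt (Nat.cast_nonneg N) hp
  have key : ∀ w : VV N, |ks p s w - ks p s (w - v)| ≤ (p * 2 ^ (p+1) * (‖v‖ / s)) * ks p s w := by
    intro w
    set a := max ‖w‖ s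
    set b := max ‖w - v‖ s
    have ha : s ≤ a := le_max_right _ _
    have hb : s ≤ b := le_max_right _ _
    have hab : |a - b| ≤ ‖v‖ := by
      refine (abs_max_sub_max_le_abs _ _ _).trans ?_
      refine (abs_norm_sub_norm_le _ _).trans ?_
      simp
    have hab' := abs_le.1 hab
    have hmin : ∀ m, a / 2 ≤ m → p * m ^ (-p-1) * |a - b| ≤ (p * 2 ^ (p+1) * (‖v‖ / s)) * a ^ (-p) := by
      intro m hm
      have h1 : m ^ (-p-1) ≤ (a/2) ^ (-p-1) :=
        Real.rpow_le_rpow_of_nonpos (by linarith) hm (by linarith)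
      have h2 : (a/2) ^ (-p-1) = 2 ^ (p+1) * (a ^ (-p) * a⁻¹) := by
        rw [Real.div_rpow (by linarith) (by norm_num), ← Real.rpow_neg_one a, ← Real.rpow_add (by linarith),
          div_eq_mul_inv, ← Real.rpow_neg (by norm_num), mul_comm]
        congr 2; ring
      have h3 : a⁻¹ ≤ s⁻¹ := inv_anti₀ hs ha
      calc p * m ^ (-p-1) * |a - b| ≤ p * (2 ^ (p+1) * (a ^ (-p) * s⁻¹)) * ‖v‖ := by
            gcongr
            rw [h2] at h1
            refine h1.trans ?_
            gcongr
        _ = _ := by rw [div_eq_mul_inv]; ring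
    show |a ^ (-p) - b ^ (-p)| ≤ _ * a ^ (-p)
    rcases le_total a b with h | h
    · have h1 := (rpow_diff hp0 (by linarith) h).2
      have h0 := (rpow_diff hp0 (by linarith) h).1
      have h0' : 0 ≤ p * b ^ (-p - 1) * (b - a) := by
        have : 0 < b := by linarith
        have : 0 ≤ b - a := by linarith
        positivity
      rw [abs_of_nonneg (by linarith)]
      have := hmin a (by linarith)
      rw [abs_of_nonpos (by linarith : a - b ≤ 0), neg_sub] at this
      linarith
    · have h1 := (rpow_diff hp0 (by linarith) h).2
      have h0 := (rpow_diff hp0 (by linarith) h).1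
      have h0' : 0 ≤ p * a ^ (-p - 1) * (a - b) := by
        have : 0 < a := by linarith
        have : 0 ≤ a - b := by linarith
        positivity
      rw [abs_of_nonpos (by linarith)]
      have := hmin b (by linarith)
      rw [abs_of_nonneg (by linarith : 0 ≤ a - b)] at this
      linarith
  have hi := ks_integrable (N := N) hp hs
  have h := integral_mono ((hi.sub (hi.comp_sub_right v)).abs) (hi.const_mul _) key
  refine h.trans (le_of_eq ?_)
  rw [integral_const_mul, ks_int hs]; ring


lemma main_neg {N : ℕ} [Nontrivial (VV N)] {e : VV N} (he : ‖e‖ = 1) {l p : ℝ} {E : Set (VV N)}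
    (hE : IsOpen E) (hP : ∀ x ∈ E, l < inner ℝ x e → rf e l x ∈ E) (hp : (N : ℝ) < p) (x0 : VV N)
    (hbad : volume {y : VV N | l < inner ℝ y e ∧ y ∉ E ∧ rf e l y ∈ E} ≠ 0) :
    ∃ c0 > 0, ∃ η > 0, ∀ x : VV N, ∀ s, ‖x - x0‖ ≤ η → 0 < s → s ≤ η → 0 < inner ℝ x e - l →
      ∫ w, (tau E (x + w) - tau E (rf e l (x + w))) * ks p s w ≤ -c0 * (inner ℝ x e - l) := by
  have hp0 : 0 < p := lt_of_le_of_lt (Nat.cast_nonneg N) hp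
  set K : ℕ → Set (VV N) := fun n => {y | l + 1 / ((n:ℝ)+1) ≤ inner ℝ y e ∧ y ∉ E ∧ rf e l y ∈ E ∧
    1 / ((n:ℝ)+1) ≤ ‖y - x0‖ ∧ ‖y - x0‖ ≤ n} with hK
  have hex : ∃ n, volume (K n) ≠ 0 := by
    by_contra! hcon
    apply hbad
    have hsub : {y : VV N | l < inner ℝ y e ∧ y ∉ E ∧ rf e l y ∈ E} ⊆ (⋃ n, K n) ∪ {x0} := by
      rintro y ⟨h1, h2, h3⟩
      by_cases hy : y = x0
      · right; exact hy
      left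
      have hy' : 0 < ‖y - x0‖ := norm_pos_iff.2 (sub_ne_zero.2 hy)
      obtain ⟨n1, hn1⟩ := exists_nat_one_div_lt (sub_pos.2 h1)
      obtain ⟨n2, hn2⟩ := exists_nat_one_div_lt hy'
      obtain ⟨n3, hn3⟩ := exists_nat_ge ‖y - x0‖
      refine Set.mem_iUnion.2 ⟨max n1 (max n2 n3), ?_, h2, h3, ?_, ?_⟩
      · have : 1 / (((max n1 (max n2 n3) : ℕ):ℝ)+1) ≤ 1 / ((n1:ℝ)+1) := by
          gcongr; exact le_max_left _ _
        linarith
      · have : 1 / (((max n1 (max n2 n3) : ℕ):ℝ)+1) ≤ 1 / ((n2:ℝ)+1) := by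
          gcongr; exact (le_max_left _ _).trans (le_max_right _ _)
        linarith
      · refine hn3.trans ?_
        exact_mod_cast (le_max_right _ _).trans (le_max_right _ _)
    refine measure_mono_null hsub (measure_union_null (measure_iUnion_null hcon) (by simp))
  obtain ⟨n, hn⟩ := hex
  set κ : ℝ := 1 / ((n:ℝ)+1) with hκ
  have hκ0 : 0 < κ := by positivity
  have hKm : MeasurableSet (K n) := by
    have h1 : Measurable fun y : VV N => inner ℝ y e := by fun_prop
    have h2 : Measurable fun y : VV N => ‖y - x0‖ := by fun_prop
    have h3 := (rf_cont e l).measurable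
    exact (measurableSet_le measurable_const h1).inter (hE.measurableSet.compl.inter
      ((h3 hE.measurableSet).inter ((measurableSet_le measurable_const h2).inter
        (measurableSet_le h2 measurable_const))))
  have hKf : volume (K n) ≠ ⊤ := by
    refine ((measure_mono ?_).trans_lt (measure_closedBall_lt_top (x := x0) (r := n))).ne
    intro y hy
    rw [mem_closedBall_iff_norm]; exact hy.2.2.2.2
  set η := κ / 2 with hη
  set D := n + ‖rf e l x0 - x0‖ + η with hD
  have hD0 : 0 < D := by positivity
  set c1 := p * D ^ (-p - 1) * (2 * κ / D) with hc1
  have hc10 : 0 < c1 := by positivity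
  have hm0 : 0 < volume.real (K n) := ENNReal.toReal_pos hn hKf
  refine ⟨c1 * volume.real (K n), by positivity, η, by positivity, ?_⟩
  intro x s hx hs hsη hσ
  set σ := inner ℝ x e - l with hσd
  set F : VV N → ℝ := fun y => tau E y - tau E (rf e l y) with hF
  have hFb : ∀ y, |F y| ≤ 2 := by
    intro y
    refine (abs_sub _ _).trans ?_
    rw [tau_abs, tau_abs]; norm_num
  have hFm : Measurable F := (tau_meas hE.measurableSet).sub
    ((tau_meas hE.measurableSet).comp (rf_cont e l).measurable)
  have hki := ks_integrable (N := N) hp hs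
  have hgi : Integrable fun y => F y * ks p s (y - x) :=
    (hki.comp_sub_right x).bdd_mul (c := 2) hFm.aestronglyMeasurable (ae_of_all _ hFb)
  have e1 : ∫ w, (tau E (x + w) - tau E (rf e l (x + w))) * ks p s w
      = ∫ y, F y * ks p s (y - x) := by
    rw [← integral_add_left_eq_self (fun y => F y * ks p s (y - x)) x]
    simp [hF]
  have hmp := rf_mp e l
  have hem := rf_me he l
  have e2 : ∫ y, F (rf e l y) * ks p s (rf e l y - x) = ∫ y, F y * ks p s (y - x) :=
    hmp.integral_comp hem (fun y => F y * ks p s (y - x))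
  have hgi2 : Integrable fun y => F (rf e l y) * ks p s (rf e l y - x) :=
    (hmp.integrable_comp_emb hem (g := fun y => F y * ks p s (y - x))).2 hgi
  have hFr : ∀ y, F (rf e l y) = - F y := by intro y; simp [hF, rf_rf he]
  have e3 : ∫ y, (F y * ks p s (y - x) + F (rf e l y) * ks p s (rf e l y - x))
      = 2 * ∫ y, F y * ks p s (y - x) := by
    rw [integral_add hgi hgi2, e2]; ring
  have hbound : ∀ y, F y * ks p s (y - x) + F (rf e l y) * ks p s (rf e l y - x) ≤
      (K n).indicator (fun _ => -2 * c1 * σ) y := by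
    intro y
    rw [hFr]
    have hd := rf_dist he l x y
    by_cases hy : y ∈ K n
    · rw [Set.indicator_of_mem hy]
      obtain ⟨k1, k2, k3, k4, k5⟩ := hy
      have hFy : F y = -2 := by simp [hF, tau, k2, k3]; norm_num
      rw [hFy]
      have hd1 : η ≤ ‖y - x‖ := by
        have : ‖y - x0‖ ≤ ‖y - x‖ + ‖x - x0‖ := by
          have := norm_add_le (y - x) (x - x0); simpa using this
        linarith
      have hd2D : ‖rf e l y - x‖ ≤ D := by
        have e4 : rf e l y - x = (Rl e (y - x0) + (rf e l x0 - x0)) - (x - x0) := by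
          have := rf_add e l x0 (y - x0)
          rw [add_sub_cancel] at this
          rw [this]; abel
        rw [e4]
        refine (norm_sub_le _ _).trans ?_
        have := norm_add_le (Rl e (y - x0)) (rf e l x0 - x0)
        rw [LinearIsometryEquiv.norm_map] at this
        linarith
      set d1 := ‖y - x‖
      set d2 := ‖rf e l y - x‖
      have hη0 : 0 < η := by positivity
      have hd20 : 0 ≤ d2 := norm_nonneg _
      have h4 : 4 * κ * σ ≤ d2 ^ 2 - d1 ^ 2 := by
        rw [hd]; gcongr; linarith
      have hκσ : 0 < κ * σ := by positivity
      have h12 : d1 ≤ d2 := (sq_le_sq₀ (norm_nonneg _) hd20).1 (by linarith)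
      rw [ks_eq (by linarith : s ≤ ‖y - x‖), ks_eq (by linarith : s ≤ ‖rf e l y - x‖)]
      have h5 := (rpow_diff hp0 (by linarith : 0 < d1) h12).1
      have h6 : 2 * κ / D * σ ≤ d2 - d1 := by
        rw [div_mul_eq_mul_div, div_le_iff₀ hD0]
        have h61 : (d2 - d1) * (d2 + d1) ≤ (d2 - d1) * (2 * D) := by
          apply mul_le_mul_of_nonneg_left <;> linarith
        linarith
      have h7 : D ^ (-p - 1) ≤ d2 ^ (-p - 1) :=
        Real.rpow_le_rpow_of_nonpos (by linarith) hd2D (by linarith)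
      have h8 : c1 * σ ≤ p * d2 ^ (-p - 1) * (d2 - d1) := by
        rw [hc1, mul_assoc]; gcongr
      linarith
    · rw [Set.indicator_of_notMem hy]
      have : F y * (ks p s (y - x) - ks p s (rf e l y - x)) ≤ 0 := by
        rcases lt_trichotomy l (inner ℝ y e) with h | h | h
        · apply mul_nonpos_of_nonpos_of_nonneg
          · exact sub_nonpos.2 (tau_le fun hyE => hP y hyE h)
          · refine sub_nonneg.2 (ks_anti hp0 hs ?_)
            apply (sq_le_sq₀ (norm_nonneg _) (norm_nonneg _)).1
            have : 0 ≤ 4 * (inner ℝ y e - l) * σ := by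
              have : 0 ≤ inner ℝ y e - l := by linarith
              positivity
            linarith
        · have : rf e l y = y := by rw [rf_apply he, ← h]; simp
          simp [this]
        · apply mul_nonpos_of_nonneg_of_nonpos
          · refine sub_nonneg.2 (tau_le fun hyE => ?_)
            have := hP _ hyE (by rw [rf_inner he]; linarith)
            rwa [rf_rf he] at this
          · refine sub_nonpos.2 (ks_anti hp0 hs ?_)
            apply (sq_le_sq₀ (norm_nonneg _) (norm_nonneg _)).1
            have : 0 ≤ 4 * (l - inner ℝ y e) * σ := by
              have : 0 ≤ l - inner ℝ y e := by linarith
              positivity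
            linarith
      linarith
  have h9 := integral_mono (hgi.add hgi2) ((integrable_indicator_iff hKm).2
    (integrableOn_const hKf)) hbound
  rw [integral_indicator_const _ hKm] at h9
  simp only [Pi.add_apply] at h9
  rw [e3] at h9
  rw [e1]
  simp only [smul_eq_mul] at h9
  linarith

lemma cv {N : ℕ} (S : VV N ≃ₗᵢ[ℝ] VV N) (q : VV N) (E : Set (VV N)) (ε p : ℝ) :
    ∫ y in {y | ε ≤ dist y q}, tau E y * dist q y ^ (-p) =
    ∫ w in {w | ε ≤ ‖w‖}, tau E (q + S w) * ‖w‖ ^ (-p) := by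
  have hmp : MeasurePreserving (fun w => q + S w) :=
    (measurePreserving_add_left (volume : Measure (VV N)) q).comp S.measurePreserving
  have hem : MeasurableEmbedding (fun w => q + S w) :=
    (S.toHomeomorph.trans (Homeomorph.addLeft q)).measurableEmbedding
  rw [← hmp.setIntegral_preimage_emb hem]
  simp

lemma k_intOn {N : ℕ} {p ε : ℝ} (hp : (N : ℝ) < p) (hε : 0 < ε) :
    IntegrableOn (fun w : VV N => ‖w‖ ^ (-p)) {w | ε ≤ ‖w‖} := by
  refine (ks_integrable (N := N) hp hε).integrableOn.congr_fun (fun w hw => ks_eq hw) ?_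
  exact measurableSet_le measurable_const measurable_norm

lemma lim_lemma {N : ℕ} [Nontrivial (VV N)] {p s b : ℝ} (hp : (N : ℝ) < p) (hs : 0 < s)
    {f : VV N → ℝ} (hf : Measurable f) (hfb : ∀ w, |f w| ≤ 2)
    (hT : Tendsto (fun ε : ℝ => ∫ w in {w | ε ≤ ‖w‖}, f w * ‖w‖ ^ (-p)) (𝓝[>] 0) (𝓝 0))
    (hb : ∀ ε > 0, ∫ w in {w | ε ≤ ‖w‖}, f w * (‖w‖ ^ (-p) - ks p s w) ≤ b) :
    0 ≤ b + ∫ w, f w * ks p s w := by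
  have hki := ks_integrable (N := N) hp hs
  have hgi : Integrable fun y => f y * ks p s y :=
    hki.bdd_mul (c := 2) hf.aestronglyMeasurable (ae_of_all _ hfb)
  have hms : ∀ ε : ℝ, MeasurableSet {w : VV N | ε ≤ ‖w‖} := fun ε =>
    measurableSet_le measurable_const measurable_norm
  have h1 : Tendsto (fun ε : ℝ => ∫ w in {w | ε ≤ ‖w‖}, f w * ks p s w) (𝓝[>] 0)
      (𝓝 (∫ w, f w * ks p s w)) := by
    simp_rw [fun ε : ℝ => (integral_indicator (f := fun w => f w * ks p s w) (μ := volume) (hms ε)).symm]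
    refine tendsto_integral_filter_of_dominated_convergence (fun w => ‖f w * ks p s w‖) ?_ ?_ hgi.norm ?_
    · exact Eventually.of_forall fun ε => hgi.aestronglyMeasurable.indicator (hms ε)
    · exact Eventually.of_forall fun ε => ae_of_all _ fun w => norm_indicator_le_norm_self _ _
    · have : ∀ᵐ w : VV N, w ≠ 0 := by simp [ae_iff]
      filter_upwards [this] with w hw
      refine tendsto_const_nhds.congr' ?_
      have hw' : 0 < ‖w‖ := norm_pos_iff.2 hw
      filter_upwards [Ioo_mem_nhdsGT hw'] with ε hε
      rw [Set.indicator_of_mem]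
      exact hε.2.le
  have h2 : ∀ᶠ ε in 𝓝[>] (0:ℝ), ∫ w in {w | ε ≤ ‖w‖}, f w * ‖w‖ ^ (-p) ≤
      b + ∫ w in {w | ε ≤ ‖w‖}, f w * ks p s w := by
    filter_upwards [self_mem_nhdsWithin] with ε hε
    have := hb ε hε
    simp_rw [mul_sub] at this
    rw [integral_sub _ hgi.integrableOn] at this
    · linarith
    · exact (k_intOn hp hε).bdd_mul (c := 2) hf.aestronglyMeasurable (ae_of_all _ hfb)
  exact le_of_tendsto_of_tendsto hT (h1.const_add b) h2

lemma slab {N : ℕ} {ν : VV N} (hν : ‖ν‖ = 1) {g : VV N → ℝ} (hg : Continuous g)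
    (hgν : ∀ w (t : ℝ), g (w + t • ν) = g w) {ρ η : ℝ} (hρ : 0 < ρ) (hη : 0 < η) :
    volume.real {w : VV N | ‖w‖ ≤ ρ ∧ |inner ℝ w ν - g w| ≤ η} ≤
      3 * η / ρ * (2 * ρ) ^ N * volume.real (Metric.ball (0 : VV N) 1) := by
  set S := {w : VV N | ‖w‖ ≤ ρ ∧ |inner ℝ w ν - g w| ≤ η} with hS
  have hSm : MeasurableSet S := by
    have h1 : Measurable fun w => |inner ℝ w ν - g w| :=
      (by fun_prop : Continuous fun w => |inner ℝ w ν - g w|).measurable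
    exact (measurableSet_le measurable_norm measurable_const).inter
      (measurableSet_le h1 measurable_const)
  set J := ⌊ρ / (3 * η)⌋₊ with hJ
  have hJ1 : (J : ℝ) * (3 * η) ≤ ρ := by
    rw [← le_div_iff₀ (by positivity)]; exact Nat.floor_le (by positivity)
  have hJ2 : ρ / (3 * η) ≤ J + 1 := (Nat.lt_floor_add_one _).le
  set T : ℕ → Set (VV N) := fun j => (fun w => w + (-(j * (3 * η)) : ℝ) • ν) ⁻¹' S with hT
  have hTv : ∀ j, volume (T j) = volume S := fun j => by
    rw [hT]; exact measure_preimage_add_right _ _ _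
  have hTm : ∀ j, MeasurableSet (T j) := fun j => hSm.preimage (by fun_prop)
  have hdis : Pairwise (Function.onFun Disjoint T) := by
    intro i j hij
    refine Set.disjoint_left.2 ?_
    rintro w ⟨-, h1⟩ ⟨-, h2⟩
    simp only [hgν, inner_add_left, inner_smul_left, inner_ee hν] at h1 h2
    simp only [RCLike.conj_to_real, mul_one] at h1 h2
    rw [abs_le] at h1 h2
    have : (1:ℝ) ≤ |(i:ℝ) - j| := by
      have : (1:ℤ) ≤ |(i:ℤ) - j| := Int.one_le_abs (by omega)
      exact_mod_cast this
    rcases le_abs.1 this with h | h <;> nlinarith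
  have hsub : ⋃ j ∈ Finset.range (J+1), T j ⊆ Metric.closedBall 0 (2 * ρ) := by
    intro w hw
    simp only [Set.mem_iUnion, Finset.mem_range] at hw
    obtain ⟨j, hj, h1, -⟩ := hw
    rw [mem_closedBall_zero_iff]
    have e1 : w = (w + (-(j * (3 * η)) : ℝ) • ν) + ((j * (3 * η)) : ℝ) • ν := by module
    have hj' : (j : ℝ) ≤ J := by exact_mod_cast Nat.lt_succ_iff.1 hj
    have h2 : ‖((j * (3 * η)) : ℝ) • ν‖ ≤ ρ := by
      rw [norm_smul, hν, mul_one, Real.norm_of_nonneg (by positivity)]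
      refine le_trans ?_ hJ1
      gcongr
    rw [e1]
    refine (norm_add_le _ _).trans ?_
    dsimp only at h1
    linarith
  have h1 := measure_mono (μ := volume) hsub
  rw [measure_biUnion_finset (fun i _ j _ hij => hdis hij) (fun j _ => hTm j)] at h1
  simp only [hTv, Finset.sum_const, Finset.card_range] at h1
  have h2 := ENNReal.toReal_mono measure_closedBall_lt_top.ne h1
  rw [Measure.addHaar_closedBall _ _ (by positivity)] at h2
  simp only [nsmul_eq_mul, ENNReal.toReal_mul, ENNReal.toReal_natCast, finrank_euclideanSpace,
    Fintype.card_fin] at h2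
  rw [ENNReal.toReal_ofReal (by positivity)] at h2
  change ((J+1 : ℕ):ℝ) * volume.real S ≤ _ * volume.real (Metric.ball (0 : VV N) 1) at h2
  push_cast at h2
  have h3 : ρ / (3 * η) * volume.real S ≤ (2 * ρ) ^ N * volume.real (Metric.ball (0 : VV N) 1) :=
    le_trans (by gcongr) h2
  rw [div_mul_eq_mul_div, div_le_iff₀ (by positivity)] at h3
  rw [mul_assoc, div_mul_eq_mul_div, le_div_iff₀ hρ]
  linarith

lemma dyadic {N : ℕ} {α : ℝ} (hα : α ∈ Set.Ioo (0:ℝ) 1) :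
    ∃ C > 0, ∀ (S : Set (VV N)) (s m : ℝ), MeasurableSet S → 0 < s → 0 ≤ m →
      (∀ ρ, 0 < ρ → ρ ≤ s → volume.real (S ∩ Metric.closedBall 0 ρ) ≤ m * ρ ^ (N+1)) →
      ∀ ε > 0, ∫ w in S ∩ {w | ε ≤ ‖w‖ ∧ ‖w‖ ≤ s}, ‖w‖ ^ (-((N:ℝ)+α)) ≤ C * m * s ^ (1-α) := by
  set p := (N:ℝ) + α with hp
  have hNp : (N:ℝ) < p := by linarith [hα.1]
  have hp0 : 0 < p := lt_of_le_of_lt (Nat.cast_nonneg N) hNp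
  set q : ℝ := (1/2 : ℝ) ^ (1-α) with hq
  have hq0 : 0 < q := by positivity
  have hq1 : q < 1 := Real.rpow_lt_one (by norm_num) (by norm_num) (by linarith [hα.2])
  have hq2 : 0 < 1 - q := by linarith
  refine ⟨2 ^ p * (1 - q)⁻¹, by positivity, ?_⟩
  intro S s m hS hs hm hvol ε hε
  have hAm : ∀ a b : ℝ, MeasurableSet {w : VV N | a < ‖w‖ ∧ ‖w‖ ≤ b} := fun a b =>
    (measurableSet_lt measurable_const measurable_norm).inter
      (measurableSet_le measurable_norm measurable_const)
  have hio : ∀ a b : ℝ, 0 < a → IntegrableOn (fun w : VV N => ‖w‖ ^ (-p)) (S ∩ {w | a < ‖w‖ ∧ ‖w‖ ≤ b}) :=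
    fun a b ha => (k_intOn hNp ha).mono_set fun w hw => hw.2.1.le
  have ind : ∀ n : ℕ, ∫ w in S ∩ {w | (1/2:ℝ)^n * s < ‖w‖ ∧ ‖w‖ ≤ s}, ‖w‖ ^ (-p) ≤
      2 ^ p * m * s ^ (1-α) * ∑ j ∈ Finset.range n, q ^ j := by
    intro n
    induction n with
    | zero =>
      have : {w : VV N | (1/2:ℝ)^0 * s < ‖w‖ ∧ ‖w‖ ≤ s} = ∅ := by
        ext w; simp
      rw [this]; simp
    | succ n ih =>
      set ρ := (1/2:ℝ)^n * s with hρ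
      have hρ0 : 0 < ρ := by positivity
      have hρs : ρ ≤ s := by
        rw [hρ]; exact mul_le_of_le_one_left hs.le (pow_le_one₀ (by norm_num) (by norm_num))
      have e0 : (1/2:ℝ)^(n+1) * s = ρ / 2 := by rw [hρ]; ring
      rw [e0]
      have e1 : S ∩ {w | ρ/2 < ‖w‖ ∧ ‖w‖ ≤ s} =
          (S ∩ {w | ρ < ‖w‖ ∧ ‖w‖ ≤ s}) ∪ (S ∩ {w | ρ/2 < ‖w‖ ∧ ‖w‖ ≤ ρ}) := by
        ext w
        simp only [Set.mem_inter_iff, Set.mem_union, Set.mem_setOf_eq]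
        constructor
        · rintro ⟨h1, h2, h3⟩
          by_cases h : ρ < ‖w‖
          · exact Or.inl ⟨h1, h, h3⟩
          · exact Or.inr ⟨h1, h2, not_lt.1 h⟩
        · rintro (⟨h1, h2, h3⟩ | ⟨h1, h2, h3⟩)
          · exact ⟨h1, by linarith, h3⟩
          · exact ⟨h1, h2, by linarith⟩
      rw [e1, setIntegral_union _ (hS.inter (hAm _ _)) (hio _ _ hρ0) (hio _ _ (by linarith))]
      · have hle : ∫ w in S ∩ {w | ρ/2 < ‖w‖ ∧ ‖w‖ ≤ ρ}, ‖w‖ ^ (-p) ≤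
            (ρ/2) ^ (-p) * (m * ρ ^ (N+1)) := by
          have hfin : volume (S ∩ Metric.closedBall (0 : VV N) ρ) ≠ ⊤ :=
            ((measure_mono Set.inter_subset_right).trans_lt measure_closedBall_lt_top).ne
          have hss : S ∩ {w | ρ/2 < ‖w‖ ∧ ‖w‖ ≤ ρ} ⊆ S ∩ Metric.closedBall (0 : VV N) ρ := by
            rintro w ⟨h1, -, h3⟩; exact ⟨h1, by simpa using h3⟩
          have hfin2 := ((measure_mono (μ := volume) hss).trans_lt hfin.lt_top).ne
          calc ∫ w in S ∩ {w | ρ/2 < ‖w‖ ∧ ‖w‖ ≤ ρ}, ‖w‖ ^ (-p)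
              ≤ ∫ w in S ∩ {w | ρ/2 < ‖w‖ ∧ ‖w‖ ≤ ρ}, (ρ/2) ^ (-p) := by
                refine setIntegral_mono_on (hio _ _ (by linarith)) (integrableOn_const hfin2)
                  (hS.inter (hAm _ _)) ?_
                intro w hw
                exact Real.rpow_le_rpow_of_nonpos (by linarith) hw.2.1.le (by linarith)
            _ = (ρ/2) ^ (-p) * volume.real (S ∩ {w | ρ/2 < ‖w‖ ∧ ‖w‖ ≤ ρ}) := by
                rw [setIntegral_const, smul_eq_mul, mul_comm]
            _ ≤ _ := by
                gcongr
                exact (measureReal_mono hss hfin).trans (hvol ρ hρ0 hρs)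
        have e2 : (ρ/2) ^ (-p) * (m * ρ ^ (N+1)) = 2 ^ p * m * s ^ (1-α) * q ^ n := by
          rw [Real.div_rpow hρ0.le (by norm_num), Real.rpow_neg (by norm_num : (0:ℝ) ≤ 2), div_inv_eq_mul]
          have e3 : ρ ^ (-p) * ρ ^ (N+1) = s ^ (1-α) * q ^ n := by
            rw [← Real.rpow_natCast ρ, ← Real.rpow_add hρ0]
            have : -p + ((N+1 : ℕ):ℝ) = 1 - α := by rw [hp]; push_cast; ring
            rw [this, hρ, Real.mul_rpow (by positivity) hs.le, hq, ← Real.rpow_natCast (1/2:ℝ),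
              ← Real.rpow_mul (by norm_num), ← Real.rpow_natCast _ n, ← Real.rpow_mul (by norm_num),
              mul_comm (n:ℝ), mul_comm]
          linear_combination 2 ^ p * m * e3
        rw [Finset.sum_range_succ, mul_add]
        linarith
      · refine Set.disjoint_left.2 ?_
        rintro w ⟨-, h1, -⟩ ⟨-, -, h2⟩
        linarith
  obtain ⟨n, hn⟩ := exists_pow_lt_of_lt_one (div_pos hε hs) (by norm_num : (1/2:ℝ) < 1)
  rw [lt_div_iff₀ hs] at hn
  have h1 : ∫ w in S ∩ {w | ε ≤ ‖w‖ ∧ ‖w‖ ≤ s}, ‖w‖ ^ (-p) ≤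
      ∫ w in S ∩ {w | (1/2:ℝ)^n * s < ‖w‖ ∧ ‖w‖ ≤ s}, ‖w‖ ^ (-p) := by
    refine setIntegral_mono_set (hio _ _ (by positivity)) (ae_of_all _ fun w => by positivity) ?_
    refine HasSubset.Subset.eventuallyLE ?_
    rintro w ⟨h1, h2, h3⟩
    exact ⟨h1, by linarith, h3⟩
  have h2 : ∑ j ∈ Finset.range n, q ^ j ≤ (1 - q)⁻¹ := by
    rw [← tsum_geometric_of_lt_one hq0.le hq1]
    exact (summable_geometric_of_lt_one hq0.le hq1).sum_le_tsum _ fun _ _ => by positivity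
  calc _ ≤ _ := h1.trans (ind n)
    _ ≤ 2 ^ p * m * s ^ (1-α) * (1 - q)⁻¹ := by gcongr
    _ = _ := by ring


structure Chart {N : ℕ} (E : Set (VV N)) (β : ℝ) (x0 ν : VV N) (r M : ℝ) (H : VV N → ℝ) : Prop where
  hν : ‖ν‖ = 1
  hr : 0 < r
  hM : 0 ≤ M
  cd : ContDiff ℝ 2 H
  h0 : H 0 = 0
  d0 : fderiv ℝ H 0 = 0
  inv : ∀ z (t : ℝ), H (z + t • ν) = H z
  hol : ∀ z, ‖fderiv ℝ (fderiv ℝ H) z - fderiv ℝ (fderiv ℝ H) 0‖ ≤ M * ‖z‖ ^ β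
  Bl : ∀ v, fderiv ℝ (fderiv ℝ H) 0 ν v = 0
  Br : ∀ v, fderiv ℝ (fderiv ℝ H) 0 v ν = 0
  memE : ∀ z, ‖z‖ < r → (x0 + z ∈ E ↔ inner ℝ z ν < H z)
  memF : ∀ z, ‖z‖ < r → (x0 + z ∈ frontier E ↔ inner ℝ z ν = H z)

lemma exists_chart {N : ℕ} (hN : 2 ≤ N) {E : Set (VV N)} {β : ℝ} (hβ : 0 < β)
    (hb : HasC2HolderBoundary E β) {x : VV N} (hx : x ∈ frontier E) :
    ∃ ν r M H, Chart E β x ν r M H := by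
  obtain ⟨r, A, h, M, hr, hcd, h0, hd0, hhol, hmem⟩ := hb x hx
  set last : Fin N := ⟨N - 1, by omega⟩ with hlast
  let π0 : VV N →ₗ[ℝ] VV (N - 1) :=
    { toFun := fun z => WithLp.toLp 2 (fun i : Fin (N-1) => z ⟨i, by omega⟩)
      map_add' := fun a b => by ext i; simp
      map_smul' := fun c a => by ext i; simp }
  let π : VV N →L[ℝ] VV (N-1) := LinearMap.toContinuousLinearMap π0
  have hπ : ∀ z i, π z i = z ⟨i, by omega⟩ := fun z i => rfl
  have hπn : ∀ z, ‖π z‖ ≤ ‖z‖ := by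
    intro z
    rw [EuclideanSpace.norm_eq, EuclideanSpace.norm_eq]
    apply Real.sqrt_le_sqrt
    have hinj : Function.Injective (fun i : Fin (N-1) => (⟨i, by omega⟩ : Fin N)) := by
      intro i j hij; simpa [Fin.ext_iff] using hij
    have := Finset.sum_map Finset.univ ⟨_, hinj⟩ (fun j => ‖z j‖ ^ 2)
    simp only [Function.Embedding.coeFn_mk] at this
    simp_rw [hπ]
    rw [← this]
    exact Finset.sum_le_sum_of_subset_of_nonneg (Finset.subset_univ _) fun _ _ _ => by positivity
  have hgp : ∀ z : VV N, graphPt N (π z) (z last) = z := by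
    intro z
    ext i
    unfold graphPt
    simp only [EuclideanSpace.equiv, PiLp.continuousLinearEquiv_symm_apply]
    by_cases hi : (i:ℕ) < N - 1
    · simp [hi, hπ]
    · have : i = last := by ext; simp [hlast]; omega
      subst this
      simp [hlast]
  have hg1 : graphPt N 0 1 = EuclideanSpace.single last (1:ℝ) := by
    ext i
    unfold graphPt
    simp only [EuclideanSpace.equiv, PiLp.continuousLinearEquiv_symm_apply]
    by_cases hi : (i:ℕ) < N - 1
    · have : i ≠ last := by rw [ne_eq, Fin.ext_iff]; simp [hlast]; omega
      simp [hi, this]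
    · have : i = last := by ext; simp [hlast]; omega
      subst this
      simp [hlast]
  set ν := A (EuclideanSpace.single last (1:ℝ)) with hν
  let Lm : VV N →L[ℝ] VV (N-1) := π ∘L (A.symm.toContinuousLinearEquiv : VV N →L[ℝ] VV N)
  have hL : ∀ z, Lm z = π (A.symm z) := fun z => rfl
  have hLn : ∀ z, ‖Lm z‖ ≤ ‖z‖ := fun z => by
    rw [hL]; refine (hπn _).trans ?_; rw [LinearIsometryEquiv.norm_map]
  have hLν : Lm ν = 0 := by
    rw [hL, hν, LinearIsometryEquiv.symm_apply_apply]
    ext i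
    rw [hπ]
    have : (⟨i, by omega⟩ : Fin N) ≠ last := by
      rw [ne_eq, Fin.ext_iff]; simp [hlast]; omega
    simp [this]
  have hin : ∀ z, inner ℝ z ν = (A.symm z) last := by
    intro z
    have := LinearIsometryEquiv.inner_map_map A (A.symm z) (EuclideanSpace.single last (1:ℝ))
    rw [LinearIsometryEquiv.apply_symm_apply] at this
    rw [hν, this, EuclideanSpace.inner_single_right]
    simp
  have hν1 : ‖ν‖ = 1 := by rw [hν, LinearIsometryEquiv.norm_map]; simp
  have hcdH : ContDiff ℝ 2 (h ∘ Lm) := hcd.comp Lm.contDiff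
  have hit : ∀ z u v, fderiv ℝ (fderiv ℝ (h ∘ Lm)) z u v = iteratedFDeriv ℝ 2 h (Lm z) ![Lm u, Lm v] := by
    intro z u v
    have e1 := ContinuousLinearMap.iteratedFDeriv_comp_right Lm hcd z (i := 2) le_rfl
    have e2 := iteratedFDeriv_two_apply (𝕜 := ℝ) (h ∘ Lm) z ![u, v]
    rw [e1] at e2
    simp only [ContinuousMultilinearMap.compContinuousLinearMap_apply] at e2
    simp only [Matrix.cons_val_zero, Matrix.cons_val_one] at e2
    rw [← e2]
    congr 1
    ext i
    fin_cases i <;> rfl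
  have key : ∀ z, ‖z‖ < r → x + A (graphPt N (Lm z) (inner ℝ z ν)) = x + z := by
    intro z _
    rw [hL, hin, hgp, LinearIsometryEquiv.apply_symm_apply]
  have hab : ∀ z, ‖z‖ < r → |inner ℝ z ν| < r := by
    intro z hz
    have := abs_real_inner_le_norm z ν
    rw [hν1, mul_one] at this
    linarith
  refine ⟨ν, r, |M|, h ∘ Lm, ⟨hν1, hr, abs_nonneg _, hcdH, ?_, ?_, ?_, ?_, ?_, ?_, ?_, ?_⟩⟩
  · simp [h0]
  · rw [fderiv_comp _ (hcd.differentiable (by norm_num) _) Lm.differentiableAt]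
    simp [hd0]
  · intro z t
    simp [hLν]
  · intro z
    refine ContinuousLinearMap.opNorm_le_bound₂ _ (by positivity) fun u v => ?_
    simp only [ContinuousLinearMap.sub_apply]
    rw [hit, hit, ← ContinuousMultilinearMap.sub_apply]
    refine (ContinuousMultilinearMap.le_opNorm _ _).trans ?_
    rw [Fin.prod_univ_two]
    simp only [Matrix.cons_val_zero, Matrix.cons_val_one]
    have h1 := hhol (Lm z) (Lm 0)
    have h2 : M * ‖Lm z - Lm 0‖ ^ β ≤ |M| * ‖z‖ ^ β := by
      rw [map_zero, sub_zero]
      have := hLn z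
      gcongr
      exact le_abs_self _
    have h3 := hLn u
    have h4 := hLn v
    rw [mul_assoc _ ‖u‖]
    have := h1.trans h2
    gcongr
  · intro v
    rw [hit, hLν]
    exact ContinuousMultilinearMap.map_coord_zero _ 0 rfl
  · intro v
    rw [hit, hLν]
    exact ContinuousMultilinearMap.map_coord_zero _ 1 rfl
  · intro z hz
    rw [← key z hz]
    exact (hmem (Lm z) (inner ℝ z ν) ((hLn z).trans_lt hz) (hab z hz)).1
  · intro z hz
    rw [← key z hz]
    exact (hmem (Lm z) (inner ℝ z ν) ((hLn z).trans_lt hz) (hab z hz)).2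

lemma rot {N : ℕ} {u v : VV N} (hu : ‖u‖ = 1) (hv : ‖v‖ = 1) :
    ∃ Q : VV N ≃ₗᵢ[ℝ] VV N, Q u = v ∧ ∀ w, ‖Q w - w‖ ≤ 4 * ‖u - v‖ * ‖w‖ := by
  by_cases h : 1 ≤ ‖u - v‖
  · refine ⟨(Submodule.span ℝ {u - v})ᗮ.reflection, Submodule.reflection_sub (by rw [hu, hv]), ?_⟩
    intro w
    refine (norm_sub_le _ _).trans ?_
    rw [LinearIsometryEquiv.norm_map]
    nlinarith [norm_nonneg w]
  push Not at h
  have h2 : 1 ≤ ‖u + v‖ := by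
    have e1 : u + v = (2:ℝ) • u - (u - v) := by module
    rw [e1]
    have := norm_sub_norm_le ((2:ℝ) • u) (u - v)
    rw [norm_smul, hu] at this
    norm_num at this
    linarith
  set n := ‖u + v‖ with hn
  set m := n⁻¹ • (u + v) with hm
  have hn0 : 0 < n := by linarith
  have hm1 : ‖m‖ = 1 := by
    rw [hm, norm_smul, Real.norm_of_nonneg (by positivity)]; exact inv_mul_cancel₀ hn0.ne'
  have href : ∀ a : VV N, ‖a‖ = 1 → ∀ w, (Submodule.span ℝ {a}).reflection w = (2 * inner ℝ a w) • a - w := by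
    intro a ha w
    rw [Submodule.reflection_singleton_apply, ha]
    simp [two_smul]
    module
  have hum : ‖u - m‖ ≤ ‖u - v‖ := by
    have e1 : u - m = (1/2:ℝ) • (u - v) + (1/2 - n⁻¹) • (u + v) := by rw [hm]; module
    rw [e1]
    refine (norm_add_le _ _).trans ?_
    rw [norm_smul, norm_smul, ← hn]
    have h3 : n ≤ 2 := by have := norm_add_le u v; rw [hu, hv] at this; linarith
    have h4 : 2 - n ≤ ‖u - v‖ := by
      have e2 : (2:ℝ) • u = (u + v) + (u - v) := by module
      have := norm_add_le (u + v) (u - v)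
      rw [← e2, norm_smul, hu] at this
      norm_num at this
      linarith
    have h5 : ‖(1/2 - n⁻¹ : ℝ)‖ * n = 1 - n / 2 := by
      rw [Real.norm_eq_abs, abs_of_nonpos]
      · field_simp; ring
      · have : (2:ℝ)⁻¹ ≤ n⁻¹ := inv_anti₀ hn0 h3
        norm_num at this ⊢; linarith
    rw [h5, Real.norm_of_nonneg (by norm_num)]
    linarith
  refine ⟨(Submodule.span ℝ {u}).reflection.trans (Submodule.span ℝ {m}).reflection, ?_, ?_⟩
  · rw [LinearIsometryEquiv.trans_apply, href u hu, inner_ee hu, href m hm1]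
    have e1 : (2 * 1 : ℝ) • u - u = u := by module
    rw [e1]
    have e2 : 2 * inner ℝ m u = n := by
      rw [hm, inner_smul_left]
      simp only [RCLike.conj_to_real]
      have e3 : n ^ 2 = 2 * inner ℝ (u + v) u := by
        rw [hn, norm_add_sq_real, inner_add_left, inner_ee hu, hu, hv, real_inner_comm]; ring
      field_simp
      linarith
    rw [e2, hm, smul_smul, mul_inv_cancel₀ hn0.ne']
    module
  · intro w
    rw [LinearIsometryEquiv.trans_apply]
    have e1 : (Submodule.span ℝ {m}).reflection ((Submodule.span ℝ {u}).reflection w) - w =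
        (Submodule.span ℝ {m}).reflection ((Submodule.span ℝ {u}).reflection w -
          (Submodule.span ℝ {m}).reflection w) := by
      rw [map_sub, Submodule.reflection_reflection]
    rw [e1, LinearIsometryEquiv.norm_map, href u hu, href m hm1]
    have e2 : (2 * inner ℝ u w) • u - w - ((2 * inner ℝ m w) • m - w) =
        (2:ℝ) • ((inner ℝ u w) • (u - m) + (inner ℝ (u - m) w) • m) := by
      rw [inner_sub_left]; module
    rw [e2, norm_smul, Real.norm_of_nonneg (by norm_num)]
    have h3 := norm_add_le ((inner ℝ u w) • (u - m)) ((inner ℝ (u - m) w) • m)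
    rw [norm_smul, norm_smul, hm1, Real.norm_eq_abs, Real.norm_eq_abs] at h3
    have h4 := abs_real_inner_le_norm u w
    have h5 := abs_real_inner_le_norm (u - m) w
    rw [hu] at h4
    have h6 : ‖u - m‖ * ‖w‖ ≤ ‖u - v‖ * ‖w‖ := by gcongr
    have h7 : |inner ℝ u w| * ‖u - m‖ ≤ 1 * ‖w‖ * ‖u - m‖ := by gcongr
    nlinarith

section
variable {N : ℕ} {E : Set (VV N)} {β : ℝ} {x0 ν : VV N} {r M : ℝ} {H : VV N → ℝ}

lemma Chart.mv (C : Chart E β x0 ν r M H) (hβ : 0 < β) {s : ℝ} {a u : VV N} (ha : ‖a‖ ≤ s) (hu : ‖u‖ ≤ s) :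
    ‖fderiv ℝ H (a + u) - fderiv ℝ H a - fderiv ℝ (fderiv ℝ H) 0 u‖ ≤ M * (2 * s) ^ β * ‖u‖ := by
  have hd : ContDiff ℝ 1 (fderiv ℝ H) := C.cd.fderiv_right (by norm_num)
  have h := Convex.norm_image_sub_le_of_norm_fderiv_le' (𝕜 := ℝ) (f := fderiv ℝ H)
    (φ := fderiv ℝ (fderiv ℝ H) 0) (C := M * (2 * s) ^ β) (s := Metric.closedBall 0 (2 * s))
    (x := a) (y := a + u) (fun z _ => hd.differentiable (by norm_num) z) ?_
    (convex_closedBall _ _) ?_ ?_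
  · simpa using h
  · intro z hz
    refine (C.hol z).trans ?_
    have := C.hM
    have hz' : ‖z‖ ≤ 2 * s := by simpa using hz
    gcongr
  · simp; linarith [norm_nonneg a]
  · simp; linarith [norm_add_le a u]

lemma Chart.taylor (C : Chart E β x0 ν r M H) (hβ : 0 < β) {s : ℝ} {a w : VV N} (ha : ‖a‖ ≤ s) (hw : ‖w‖ ≤ s) :
    |H (a + w) - H a - fderiv ℝ H a w - 1/2 * fderiv ℝ (fderiv ℝ H) 0 w w| ≤ M * (2 * s) ^ β * ‖w‖ ^ 2 := by
  set B := fderiv ℝ (fderiv ℝ H) 0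
  have hs : 0 ≤ s := (norm_nonneg a).trans ha
  have hM := C.hM
  have h := norm_image_sub_le_of_norm_deriv_le_segment_01' (C := M * (2 * s) ^ β * ‖w‖ ^ 2)
    (f := fun t : ℝ => H (a + t • w) - t * fderiv ℝ H a w - 1/2 * t ^ 2 * B w w)
    (f' := fun t : ℝ => fderiv ℝ H (a + t • w) w - fderiv ℝ H a w - t * B w w) ?_ ?_
  · simp only [one_smul, zero_smul, add_zero, Real.norm_eq_abs] at h
    convert h using 2
    ring
  · intro t _
    apply HasDerivAt.hasDerivWithinAt
    have h1 : HasDerivAt (fun t : ℝ => a + t • w) w t := by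
      simpa using ((hasDerivAt_id t).smul_const w).const_add a
    have h2 := (C.cd.differentiable (by norm_num) (a + t • w)).hasFDerivAt.comp_hasDerivAt t h1
    have h3 := ((hasDerivAt_id t).mul_const (fderiv ℝ H a w))
    have h4 := (((hasDerivAt_id t).pow 2).const_mul (1/2)).mul_const (B w w)
    convert (h2.sub h3).sub h4 using 1
    all_goals first | (ext t; simp; done) | (simp; done) | (simp; ring)
  · intro t ht
    have ht0 := ht.1
    have e1 : fderiv ℝ H (a + t • w) w - fderiv ℝ H a w - t * B w w =
        (fderiv ℝ H (a + t • w) - fderiv ℝ H a - B (t • w)) w := by simp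
    rw [e1]
    refine (ContinuousLinearMap.le_opNorm _ _).trans ?_
    have htw : ‖t • w‖ ≤ ‖w‖ := by
      rw [norm_smul, Real.norm_of_nonneg ht.1]
      exact mul_le_of_le_one_left (norm_nonneg _) ht.2.le
    have := C.mv hβ ha (htw.trans hw)
    calc _ ≤ M * (2 * s) ^ β * ‖t • w‖ * ‖w‖ := by gcongr
      _ ≤ M * (2 * s) ^ β * ‖w‖ * ‖w‖ := by gcongr
      _ = _ := by ring

lemma Chart.grad (C : Chart E β x0 ν r M H) (hβ : 0 < β) {s : ℝ} {a : VV N} (ha : ‖a‖ ≤ s) (hs : s ≤ 1/2) :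
    ‖fderiv ℝ H a‖ ≤ (‖fderiv ℝ (fderiv ℝ H) 0‖ + M) * s := by
  have hs0 : 0 ≤ s := (norm_nonneg a).trans ha
  have h := C.mv hβ (a := 0) (u := a) (s := s) (by simpa using hs0) ha
  have hM := C.hM
  rw [C.d0, zero_add, sub_zero] at h
  have h1 : (2 * s) ^ β ≤ 1 := Real.rpow_le_one (by linarith) (by linarith) hβ.le
  have h2 := norm_sub_norm_le (fderiv ℝ H a) (fderiv ℝ (fderiv ℝ H) 0 a)
  have h3 := ContinuousLinearMap.le_opNorm (fderiv ℝ (fderiv ℝ H) 0) a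
  have h4 : M * (2 * s) ^ β * ‖a‖ ≤ M * 1 * s := by gcongr
  have h5 : ‖fderiv ℝ (fderiv ℝ H) 0‖ * ‖a‖ ≤ ‖fderiv ℝ (fderiv ℝ H) 0‖ * s := by gcongr
  linarith

lemma Chart.Hbd (C : Chart E β x0 ν r M H) (hβ : 0 < β) {s : ℝ} {a : VV N} (ha : ‖a‖ ≤ s) (hs : s ≤ 1/2) :
    |H a| ≤ (‖fderiv ℝ (fderiv ℝ H) 0‖ + M) * s ^ 2 := by
  have hs0 : 0 ≤ s := (norm_nonneg a).trans ha
  have h := C.taylor hβ (a := 0) (w := a) (s := s) (by simpa using hs0) ha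
  have hM := C.hM
  rw [C.d0, zero_add, C.h0] at h
  simp only [sub_zero, ContinuousLinearMap.zero_apply] at h
  have h1 : (2 * s) ^ β ≤ 1 := Real.rpow_le_one (by linarith) (by linarith) hβ.le
  have h3 := ContinuousLinearMap.le_opNorm₂ (fderiv ℝ (fderiv ℝ H) 0) a a
  have h4 : M * (2 * s) ^ β * ‖a‖ ^ 2 ≤ M * 1 * s ^ 2 := by gcongr
  have h5 : ‖fderiv ℝ (fderiv ℝ H) 0‖ * ‖a‖ * ‖a‖ ≤ ‖fderiv ℝ (fderiv ℝ H) 0‖ * s * s := by gcongr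
  rw [Real.norm_eq_abs] at h3
  rw [abs_le] at *
  have h6 : 0 ≤ ‖fderiv ℝ (fderiv ℝ H) 0‖ * s * s := by positivity
  constructor <;> nlinarith

end


section
variable {N : ℕ} {E : Set (VV N)} {β : ℝ} {x0 ν : VV N} {r M : ℝ} {H : VV N → ℝ}

lemma Chart.fdν (C : Chart E β x0 ν r M H) (a : VV N) : fderiv ℝ H a ν = 0 := by
  have h1 : HasDerivAt (fun t : ℝ => a + t • ν) ν 0 := by
    simpa using ((hasDerivAt_id (0:ℝ)).smul_const ν).const_add a
  have h2 := (C.cd.differentiable (by norm_num) (a + (0:ℝ) • ν)).hasFDerivAt.comp_hasDerivAt 0 h1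
  have h3 : H ∘ (fun t : ℝ => a + t • ν) = fun _ => H a := by
    ext t; exact C.inv a t
  rw [h3] at h2
  have := h2.unique (hasDerivAt_const (0:ℝ) (H a))
  simpa using this

lemma trich {t X Y D n c : ℝ} (hn : 1 ≤ n) (hXY : |X - Y| ≤ D) (hc : (n - 1) * |Y| ≤ c)
    (h : ¬ (n * t < X ↔ t < Y)) : |t - Y| ≤ D + c := by
  have h1 := abs_le.1 hXY
  have h2 := neg_abs_le Y
  have h3 := le_abs_self Y
  have h4 := abs_nonneg Y
  rw [abs_le]
  by_cases hY : t < Y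
  · have hX : X ≤ n * t := by
      by_contra hcon; push Not at hcon; exact h ⟨fun _ => hY, fun _ => hcon⟩
    constructor
    · rcases le_total t 0 with ht | ht
      · nlinarith
      · have : (n - 1) * t ≤ (n - 1) * |Y| := by
          apply mul_le_mul_of_nonneg_left _ (by linarith); linarith
        nlinarith
    · nlinarith
  · have hX : n * t < X := by
      by_contra hcon; exact h ⟨fun h => absurd h hcon, fun h => absurd h hY⟩
    push Not at hY
    constructor
    · nlinarith
    · rcases le_total 0 t with ht | ht
      · nlinarith
      · have : (n - 1) * (-t) ≤ (n - 1) * |Y| := by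
          apply mul_le_mul_of_nonneg_left _ (by linarith); linarith
        nlinarith

lemma Chart.pt (C : Chart E β x0 ν r M H) (hβ : 0 < β) (hβ1 : β < 1) :
    ∃ K > 0, ∃ s0 > 0, ∀ s, 0 < s → s ≤ s0 → ∀ a, ‖a‖ ≤ s → inner ℝ a ν = 0 →
      ∃ Q : VV N ≃ₗᵢ[ℝ] VV N, ∀ w, ‖w‖ ≤ s →
        ¬ (x0 + a + H a • ν + Q w ∈ E ↔ inner ℝ w ν < 1/2 * fderiv ℝ (fderiv ℝ H) 0 w w) →
        |inner ℝ w ν - 1/2 * fderiv ℝ (fderiv ℝ H) 0 w w| ≤ K * s ^ β * ‖w‖ ^ 2 := by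
  set B := fderiv ℝ (fderiv ℝ H) 0 with hB
  have hM := C.hM
  have hr := C.hr
  have hν := C.hν
  set b0 := ‖B‖ + M with hb0
  have hb0' : 0 ≤ b0 := by positivity
  refine ⟨2 * M + 9 * ‖B‖ * b0 + 1, by positivity, min (1/2) (min (1/(b0+1)) (r/4)), by positivity, ?_⟩
  intro s hs hss a ha haν
  have hs1 : s ≤ 1/2 := hss.trans (min_le_left _ _)
  have hs2 : s ≤ 1/(b0+1) := hss.trans ((min_le_right _ _).trans (min_le_left _ _))
  have hs3 : s ≤ r/4 := hss.trans ((min_le_right _ _).trans (min_le_right _ _))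
  have hsb : s * (b0 + 1) ≤ 1 := by rwa [le_div_iff₀ (by positivity)] at hs2
  set g := (InnerProductSpace.toDual ℝ (VV N)).symm (fderiv ℝ H a) with hg
  have hgi : ∀ z, inner ℝ g z = fderiv ℝ H a z := fun z => by
    rw [hg, InnerProductSpace.toDual_symm_apply]
  have hgn : ‖g‖ ≤ b0 * s := by
    rw [hg, LinearIsometryEquiv.norm_map]; exact C.grad hβ ha hs1
  have hgν : inner ℝ g ν = 0 := by rw [hgi, C.fdν]
  set n := ν - g with hn
  have hnn : ‖n‖ ^ 2 = 1 + ‖g‖ ^ 2 := by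
    rw [hn, norm_sub_sq_real, real_inner_comm, hgν, hν]; ring
  have hn1 : 1 ≤ ‖n‖ := by nlinarith [norm_nonneg n, norm_nonneg g]
  have hn2 : ‖n‖ ≤ 1 + ‖g‖ := by nlinarith [norm_nonneg n, norm_nonneg g]
  set nh := (‖n‖)⁻¹ • n with hnh
  have hnpos : 0 < ‖n‖ := by linarith
  have hnh1 : ‖nh‖ = 1 := by
    rw [hnh, norm_smul, norm_inv, norm_norm]; field_simp
  have hnnh : n = ‖n‖ • nh := by rw [hnh, smul_smul, mul_inv_cancel₀ hnpos.ne', one_smul]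
  obtain ⟨Q, hQν, hQ⟩ := rot hν hnh1
  have hνnh : ‖ν - nh‖ ≤ 2 * (b0 * s) := by
    have : ν - nh = g + (‖n‖ - 1) • nh := by
      rw [sub_smul, ← hnnh, hn]; module
    rw [this]
    refine (norm_add_le _ _).trans ?_
    rw [norm_smul, hnh1, Real.norm_of_nonneg (by linarith)]
    linarith
  refine ⟨Q, fun w hw hne => ?_⟩
  have hQw : ‖Q w‖ = ‖w‖ := Q.norm_map w
  have hHa : |H a| ≤ s := by
    refine (C.Hbd hβ ha hs1).trans ?_
    rw [← hB, ← hb0]; nlinarith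
  have hz : ‖a + H a • ν + Q w‖ < r := by
    have h1 := norm_add₃_le (a := a) (b := H a • ν) (c := Q w)
    rw [norm_smul, hν, Real.norm_eq_abs, hQw] at h1
    linarith
  have hm := C.memE _ hz
  have hHz : H (a + H a • ν + Q w) = H (a + Q w) := by
    rw [← C.inv (a + Q w) (H a)]; congr 1; abel
  rw [hHz, inner_add_left, inner_add_left, haν, inner_smul_left, real_inner_self_eq_norm_sq, hν] at hm
  have hip : inner ℝ (Q w) ν = ‖n‖ * inner ℝ w ν + fderiv ℝ H a (Q w) := by
    have : ν = n + g := by rw [hn]; abel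
    calc inner ℝ (Q w) ν = inner ℝ (Q w) n + inner ℝ (Q w) g := by
          conv_lhs => rw [this]
          rw [inner_add_right]
      _ = _ := by
          rw [real_inner_comm g, hgi]
          congr 1
          conv_lhs => rw [hnnh]
          rw [inner_smul_right, ← hQν, LinearIsometryEquiv.inner_map_map]
  rw [hip] at hm
  set X := H (a + Q w) - H a - fderiv ℝ H a (Q w) with hX
  set Y := 1/2 * B w w with hY
  have hiff : x0 + a + H a • ν + Q w ∈ E ↔ ‖n‖ * inner ℝ w ν < X := by
    have : x0 + a + H a • ν + Q w = x0 + (a + H a • ν + Q w) := by abel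
    rw [this, hm, hX]
    simp
    constructor <;> intro h <;> linarith
  rw [hiff] at hne
  have hT := C.taylor hβ ha (w := Q w) (by rw [hQw]; exact hw)
  rw [hQw, ← hX, ← hB] at hT
  have hd : ‖Q w - w‖ ≤ 8 * b0 * s * ‖w‖ := by
    refine (hQ w).trans ?_
    have : 4 * ‖ν - nh‖ * ‖w‖ ≤ 4 * (2 * (b0 * s)) * ‖w‖ := by gcongr
    linarith
  have hBB : |B (Q w) (Q w) - B w w| ≤ 16 * ‖B‖ * b0 * s * ‖w‖ ^ 2 := by
    have e : B (Q w) (Q w) - B w w = B (Q w - w) (Q w) + B w (Q w - w) := by simp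
    rw [e]
    have h1 := B.le_opNorm₂ (Q w - w) (Q w)
    have h2 := B.le_opNorm₂ w (Q w - w)
    rw [hQw] at h1
    rw [Real.norm_eq_abs] at h1 h2
    have h3 : ‖B‖ * ‖Q w - w‖ * ‖w‖ ≤ ‖B‖ * (8 * b0 * s * ‖w‖) * ‖w‖ := by gcongr
    have h4 : ‖B‖ * ‖w‖ * ‖Q w - w‖ ≤ ‖B‖ * ‖w‖ * (8 * b0 * s * ‖w‖) := by gcongr
    refine (abs_add_le _ _).trans ?_
    linarith
  have hYb : |Y| ≤ 1/2 * ‖B‖ * ‖w‖ ^ 2 := by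
    rw [hY, abs_mul]
    have := B.le_opNorm₂ w w
    rw [Real.norm_eq_abs] at this
    rw [abs_of_pos (by norm_num : (0:ℝ) < 1/2)]
    linarith
  have hXY : |X - Y| ≤ M * (2 * s) ^ β * ‖w‖ ^ 2 + 8 * ‖B‖ * b0 * s * ‖w‖ ^ 2 := by
    rw [abs_le] at hT hBB ⊢
    rw [hY]
    constructor <;> linarith [hT.1, hT.2, hBB.1, hBB.2]
  have hcc : (‖n‖ - 1) * |Y| ≤ (b0 * s) * (1/2 * ‖B‖ * ‖w‖ ^ 2) := by
    gcongr; linarith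
  refine (trich hn1 hXY hcc hne).trans ?_
  have hsβ : s ≤ s ^ β := by
    conv_lhs => rw [← Real.rpow_one s]
    exact Real.rpow_le_rpow_of_exponent_ge hs (by linarith) hβ1.le
  have h2β : (2 * s) ^ β ≤ 2 * s ^ β := by
    rw [Real.mul_rpow (by norm_num) hs.le]
    have : (2:ℝ) ^ β ≤ 2 := by
      conv_rhs => rw [← Real.rpow_one 2]
      exact Real.rpow_le_rpow_of_exponent_le (by norm_num) hβ1.le
    gcongr
  have k1 : M * (2 * s) ^ β * ‖w‖ ^ 2 ≤ M * (2 * s ^ β) * ‖w‖ ^ 2 := by gcongr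
  have k2 : ‖B‖ * b0 * s * ‖w‖ ^ 2 ≤ ‖B‖ * b0 * s ^ β * ‖w‖ ^ 2 := by gcongr
  have k3 : 0 ≤ ‖B‖ * b0 * s ^ β * ‖w‖ ^ 2 := by positivity
  have k4 : 0 ≤ s ^ β * ‖w‖ ^ 2 := by positivity
  linarith
end


lemma cvk {N : ℕ} (S : VV N ≃ₗᵢ[ℝ] VV N) (F : VV N → ℝ) (ε p s : ℝ) :
    ∫ w in {w | ε ≤ ‖w‖}, F (S w) * (‖w‖ ^ (-p) - ks p s w) =
    ∫ w in {w | ε ≤ ‖w‖}, F w * (‖w‖ ^ (-p) - ks p s w) := by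
  have hmp : MeasurePreserving (fun w => S w) := S.measurePreserving
  have hem : MeasurableEmbedding (fun w => S w) := S.toHomeomorph.measurableEmbedding
  symm; rw [← hmp.setIntegral_preimage_emb hem]
  simp [ks]

lemma kd_intOn {N : ℕ} {p ε s : ℝ} (hp : (N : ℝ) < p) (hε : 0 < ε) (hs : 0 < s) :
    IntegrableOn (fun w : VV N => ‖w‖ ^ (-p) - ks p s w) {w | ε ≤ ‖w‖} :=
  (k_intOn hp hε).sub (ks_integrable hp hs).integrableOn

section
variable {N : ℕ} {E : Set (VV N)} {β : ℝ} {x0 ν : VV N} {r M : ℝ} {H : VV N → ℝ}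

lemma Chart.inner_est [Nontrivial (VV N)] {α : ℝ} (hα : α ∈ Set.Ioo (0:ℝ) 1) (hE : IsOpen E)
    (C : Chart E β x0 ν r M H) (hβ : 0 < β) (hβ1 : β < 1) :
    ∃ K > 0, ∃ s0 > 0, ∀ s, 0 < s → s ≤ s0 → ∀ a, ‖a‖ ≤ s → inner ℝ a ν = 0 →
      ∀ (S : VV N ≃ₗᵢ[ℝ] VV N), ∀ ε > 0,
      |(∫ w in {w | ε ≤ ‖w‖}, tau E (x0 + a + H a • ν + S w) * (‖w‖ ^ (-((N:ℝ)+α)) - ks ((N:ℝ)+α) s w))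
        - ∫ w in {w | ε ≤ ‖w‖}, tau {w | inner ℝ w ν < 1/2 * fderiv ℝ (fderiv ℝ H) 0 w w} w *
          (‖w‖ ^ (-((N:ℝ)+α)) - ks ((N:ℝ)+α) s w)| ≤ K * s ^ (1 + β - α) := by
  obtain ⟨K2, hK2, s0, hs0, hpt⟩ := C.pt hβ hβ1
  obtain ⟨Cd, hCd, hdy⟩ := dyadic (N := N) hα
  set p := (N:ℝ) + α with hp
  have hNp : (N:ℝ) < p := by linarith [hα.1]
  have hp0 : 0 < p := lt_of_le_of_lt (Nat.cast_nonneg N) hNp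
  set B := fderiv ℝ (fderiv ℝ H) 0 with hB
  have hgc : Continuous fun w : VV N => 1/2 * B w w := by fun_prop
  have hPqo : IsOpen {w | inner ℝ w ν < 1/2 * B w w} :=
    isOpen_lt (by fun_prop) hgc
  set Pq := {w | inner ℝ w ν < 1/2 * B w w} with hPq
  set vb := volume.real (Metric.ball (0 : VV N) 1) with hvb
  have hvb0 : 0 ≤ vb := measureReal_nonneg
  refine ⟨2 * Cd * (3 * K2 * 2 ^ N * vb) + 1, by positivity, s0, hs0, ?_⟩
  intro s hs hss a ha haν S ε hε
  obtain ⟨Q, hQ⟩ := hpt s hs hss a ha haν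
  set P := x0 + a + H a • ν with hPdef
  rw [cvk S (fun w => tau E (P + w)) ε p s, ← cvk Q (fun w => tau E (P + w)) ε p s]
  have hkd := kd_intOn (N := N) hNp hε hs
  have hAm : MeasurableSet {w : VV N | ε ≤ ‖w‖} := measurableSet_le measurable_const measurable_norm
  have hm1 : Measurable fun w => tau E (P + Q w) :=
    (tau_meas hE.measurableSet).comp (by fun_prop)
  have hm2 : Measurable (tau Pq) := tau_meas hPqo.measurableSet
  have hi1 : IntegrableOn (fun w => tau E (P + Q w) * (‖w‖ ^ (-p) - ks p s w)) {w | ε ≤ ‖w‖} :=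
    hkd.bdd_mul (c := 1) hm1.aestronglyMeasurable (ae_of_all _ fun w => by
      rw [Real.norm_eq_abs, tau_abs])
  have hi2 : IntegrableOn (fun w => tau Pq w * (‖w‖ ^ (-p) - ks p s w)) {w | ε ≤ ‖w‖} :=
    hkd.bdd_mul (c := 1) hm2.aestronglyMeasurable (ae_of_all _ fun w => by
      rw [Real.norm_eq_abs, tau_abs])
  rw [← integral_sub hi1 hi2]
  set T : Set (VV N) := {w | ¬ (P + Q w ∈ E ↔ w ∈ Pq)} with hT
  have hTm : MeasurableSet T := by
    have h1 : MeasurableSet {w | P + Q w ∈ E} := (hE.preimage (by fun_prop : Continuous fun w => P + Q w)).measurableSet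
    exact (h1.iff hPqo.measurableSet).compl
  have hdT := hdy (T ∩ {w | ‖w‖ ≤ s}) s (3 * K2 * 2 ^ N * vb * s ^ β)
    (hTm.inter (measurableSet_le measurable_norm measurable_const)) hs (by positivity) ?_ ε hε
  · have hTs : MeasurableSet (T ∩ {w | ‖w‖ ≤ s}) :=
      hTm.inter (measurableSet_le measurable_norm measurable_const)
    have hb : ∀ w, w ∈ {w : VV N | ε ≤ ‖w‖} →
        ‖tau E (P + Q w) * (‖w‖ ^ (-p) - ks p s w) - tau Pq w * (‖w‖ ^ (-p) - ks p s w)‖ ≤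
        (T ∩ {w | ‖w‖ ≤ s}).indicator (fun w => 2 * ‖w‖ ^ (-p)) w := by
      intro w hw
      have hw' : ε ≤ ‖w‖ := hw
      have hw0 : w ≠ 0 := by
        intro h; rw [h, norm_zero] at hw'; linarith
      rw [← sub_mul, norm_mul, Real.norm_eq_abs, Real.norm_eq_abs]
      by_cases h1 : w ∈ T ∩ {w | ‖w‖ ≤ s}
      · rw [Set.indicator_of_mem h1]
        have k1 := ks_le hp0 hs hw0
        have k2 := ks_nonneg (p := p) hs w
        have k3 : |tau E (P + Q w) - tau Pq w| ≤ 2 := by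
          refine (abs_sub _ _).trans ?_
          rw [tau_abs, tau_abs]; norm_num
        have k4 : |‖w‖ ^ (-p) - ks p s w| ≤ ‖w‖ ^ (-p) := by
          rw [abs_of_nonneg (by linarith)]; linarith
        gcongr
      · rw [Set.indicator_of_notMem h1]
        by_cases h2 : s ≤ ‖w‖
        · rw [ks_eq h2]; simp
        · have h3 : w ∉ T := fun h => h1 ⟨h, by simpa using (not_le.1 h2).le⟩
          have h4 : P + Q w ∈ E ↔ w ∈ Pq := by
            simpa [hT] using h3
          have : tau E (P + Q w) = tau Pq w := by unfold tau; simp only [h4]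
          rw [this]; simp
    have h5 : ∫ w in {w : VV N | ε ≤ ‖w‖}, (T ∩ {w | ‖w‖ ≤ s}).indicator (fun w => 2 * ‖w‖ ^ (-p)) w =
        2 * ∫ w in T ∩ {w | ‖w‖ ≤ s} ∩ {w | ε ≤ ‖w‖ ∧ ‖w‖ ≤ s}, ‖w‖ ^ (-p) := by
      rw [setIntegral_indicator hTs, integral_const_mul]
      congr 2
      have : {w : VV N | ε ≤ ‖w‖} ∩ (T ∩ {w | ‖w‖ ≤ s}) = T ∩ {w | ‖w‖ ≤ s} ∩ {w | ε ≤ ‖w‖ ∧ ‖w‖ ≤ s} := by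
        ext w; simp; tauto
      rw [this]
    have h6 := norm_integral_le_of_norm_le (μ := volume.restrict {w : VV N | ε ≤ ‖w‖})
      (f := fun w => tau E (P + Q w) * (‖w‖ ^ (-p) - ks p s w) - tau Pq w * (‖w‖ ^ (-p) - ks p s w))
      (g := (T ∩ {w | ‖w‖ ≤ s}).indicator (fun w => 2 * ‖w‖ ^ (-p)))
      (((k_intOn hNp hε).const_mul 2).indicator hTs)
      ((ae_restrict_iff' hAm).2 (ae_of_all _ hb))
    rw [h5, Real.norm_eq_abs] at h6
    refine h6.trans ?_
    have h7 : s ^ (1 + β - α) = s ^ β * s ^ (1 - α) := by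
      rw [← Real.rpow_add hs]; congr 1; ring
    rw [h7]
    have h8 : 0 ≤ s ^ β * s ^ (1 - α) := by positivity
    nlinarith
  · intro ρ hρ hρs
    have hsl := slab C.hν (g := fun w => 1/2 * B w w) hgc (fun w t => by
      simp [hB, C.Bl, C.Br]) (ρ := ρ) (η := K2 * s ^ β * ρ ^ 2) hρ (by positivity)
    have hsub : T ∩ {w | ‖w‖ ≤ s} ∩ Metric.closedBall 0 ρ ⊆
        {w : VV N | ‖w‖ ≤ ρ ∧ |inner ℝ w ν - 1/2 * B w w| ≤ K2 * s ^ β * ρ ^ 2} := by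
      rintro w ⟨⟨h1, h2⟩, h3⟩
      have h3' : ‖w‖ ≤ ρ := by simpa using h3
      refine ⟨h3', (hQ w h2 h1).trans ?_⟩
      gcongr
    have hfin : volume {w : VV N | ‖w‖ ≤ ρ ∧ |inner ℝ w ν - 1/2 * B w w| ≤ K2 * s ^ β * ρ ^ 2} ≠ ⊤ := by
      refine ne_top_of_le_ne_top (measure_closedBall_lt_top (x := (0 : VV N)) (r := ρ)).ne (measure_mono ?_)
      rintro w ⟨h1, _⟩; simpa using h1
    refine (measureReal_mono hsub hfin).trans (hsl.trans (le_of_eq ?_))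
    rw [mul_pow]; field_simp; try ring
end


section
variable {N : ℕ} {E : Set (VV N)} {α c : ℝ}

lemma tend_diff (hα : α ∈ Set.Ioo (0:ℝ) 1) (hE : IsOpen E)
    (hH : ∀ x ∈ frontier E, Tendsto (fun ε : ℝ => -∫ y in {y | ε ≤ dist y x},
          tau E y * dist x y ^ (-((N : ℝ) + α))) (𝓝[>] (0:ℝ)) (𝓝 c))
    {x q : VV N} (hx : x ∈ frontier E) (hq : q ∈ frontier E) (S : VV N ≃ₗᵢ[ℝ] VV N) :
    Tendsto (fun ε : ℝ => ∫ w in {w | ε ≤ ‖w‖}, (tau E (x + w) - tau E (q + S w)) *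
      ‖w‖ ^ (-((N:ℝ)+α))) (𝓝[>] 0) (𝓝 0) := by
  have h1 := (hH q hq).sub (hH x hx)
  rw [sub_self] at h1
  refine h1.congr' ?_
  filter_upwards [self_mem_nhdsWithin] with ε hε
  have hNp : (N:ℝ) < (N:ℝ) + α := by linarith [hα.1]
  have hm : ∀ (z : VV N) (T : VV N ≃ₗᵢ[ℝ] VV N), IntegrableOn (fun w => tau E (z + T w) *
      ‖w‖ ^ (-((N:ℝ)+α))) {w | ε ≤ ‖w‖} := fun z T =>
    (k_intOn hNp hε).bdd_mul (c := 1)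
      ((tau_meas hE.measurableSet).comp (by fun_prop : Measurable fun w => z + T w)).aestronglyMeasurable
      (ae_of_all _ fun w => by simp [tau_abs])
  rw [cv S q, cv (LinearIsometryEquiv.refl ℝ (VV N)) x]
  simp_rw [sub_mul]
  have h2 := hm x (LinearIsometryEquiv.refl ℝ (VV N))
  simp only [LinearIsometryEquiv.coe_refl, id_eq] at h2 ⊢
  rw [integral_sub h2 (hm q S)]
  ring

lemma case1 [Nontrivial (VV N)] (hα : α ∈ Set.Ioo (0:ℝ) 1) (hE : IsOpen E)
    (hH : ∀ x ∈ frontier E, Tendsto (fun ε : ℝ => -∫ y in {y | ε ≤ dist y x},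
          tau E y * dist x y ^ (-((N : ℝ) + α))) (𝓝[>] (0:ℝ)) (𝓝 c))
    {e : VV N} (he : ‖e‖ = 1) {l : ℝ} (hP : ∀ x ∈ E, l < inner ℝ x e → rf e l x ∈ E)
    {x : VV N} (hx : x ∈ frontier E) (hq : rf e l x ∈ frontier E) (hl : l < inner ℝ x e) :
    volume {y : VV N | l < inner ℝ y e ∧ y ∉ E ∧ rf e l y ∈ E} = 0 := by
  by_contra hbad
  have hNp : (N:ℝ) < (N:ℝ) + α := by linarith [hα.1]
  have hp0 : 0 < (N:ℝ) + α := lt_of_le_of_lt (Nat.cast_nonneg N) hNp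
  obtain ⟨c0, hc0, η, hη, hmn⟩ := main_neg he hE hP hNp x hbad
  set s := min η (inner ℝ x e - l) with hs
  have hs0 : 0 < s := lt_min hη (by linarith)
  have h1 := hmn x s (by simpa using hη.le) hs0 (min_le_left _ _) (by linarith)
  have hT := tend_diff hα hE hH hx hq (Rl e)
  simp_rw [← rf_add] at hT
  have h2 := lim_lemma (b := 0) hNp hs0 (f := fun w => tau E (x + w) - tau E (rf e l (x + w)))
    (((tau_meas hE.measurableSet).comp (by fun_prop)).sub
      ((tau_meas hE.measurableSet).comp (((rf_cont e l).comp (by fun_prop)).measurable)))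
    (fun w => by
      refine (abs_sub _ _).trans ?_
      rw [tau_abs, tau_abs]; norm_num) hT ?_
  · nlinarith
  · intro ε hε
    apply setIntegral_nonpos (measurableSet_le measurable_const measurable_norm)
    intro w hw
    have hw' : ε ≤ ‖w‖ := hw
    have hw0 : w ≠ 0 := by
      intro h; rw [h, norm_zero] at hw'; linarith
    by_cases h2 : s ≤ ‖w‖
    · rw [ks_eq h2]; simp
    · have k1 := ks_le hp0 hs0 hw0
      have k2 : tau E (x + w) ≤ tau E (rf e l (x + w)) := by
        apply tau_le
        intro h
        refine hP _ h ?_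
        rw [inner_add_left]
        have := abs_real_inner_le_norm w e
        rw [he] at this
        have h3 := neg_abs_le (inner ℝ w e)
        have h4 : s ≤ inner ℝ x e - l := min_le_right _ _
        push Not at h2
        linarith
      apply mul_nonpos_of_nonpos_of_nonneg <;> linarith


lemma Chart.onF {β : ℝ} {x0 ν : VV N} {r M : ℝ} {H : VV N → ℝ} (C : Chart E β x0 ν r M H)
    {a : VV N} (haν : inner ℝ a ν = 0) (ha : ‖a‖ + |H a| < r) : x0 + a + H a • ν ∈ frontier E := by
  rw [add_assoc, C.memF]
  · rw [C.inv, inner_add_left, haν, inner_smul_left, real_inner_self_eq_norm_sq, C.hν]; simp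
  · refine (norm_add_le _ _).trans_lt ?_
    rwa [norm_smul, C.hν, mul_one, Real.norm_eq_abs]

set_option maxHeartbeats 1000000 in
lemma case2 [Nontrivial (VV N)] (hα : α ∈ Set.Ioo (0:ℝ) 1) (hE : IsOpen E)
    (hH : ∀ x ∈ frontier E, Tendsto (fun ε : ℝ => -∫ y in {y | ε ≤ dist y x},
          tau E y * dist x y ^ (-((N : ℝ) + α))) (𝓝[>] (0:ℝ)) (𝓝 c))
    {e : VV N} (he : ‖e‖ = 1) {l : ℝ} (hP : ∀ x ∈ E, l < inner ℝ x e → rf e l x ∈ E)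
    {β : ℝ} (hβ : β ∈ Set.Ioo α 1) {x0 ν : VV N} {r M : ℝ} {H : VV N → ℝ} (C : Chart E β x0 ν r M H)
    (hx0 : inner ℝ x0 e = l) (hνe : inner ℝ ν e = 0) :
    volume {y : VV N | l < inner ℝ y e ∧ y ∉ E ∧ rf e l y ∈ E} = 0 := by
  by_contra hbad
  set p := (N:ℝ) + α with hp
  have hNp : (N:ℝ) < p := by linarith [hα.1]
  have hp0 : 0 < p := lt_of_le_of_lt (Nat.cast_nonneg N) hNp
  have hβ0 : 0 < β := hα.1.trans hβ.1
  obtain ⟨c0, hc0, η, hη, hmn⟩ := main_neg he hE hP hNp x0 hbad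
  obtain ⟨K, hK, s0, hs0, hin⟩ := C.inner_est hα hE hβ0 hβ.2
  rw [← hp] at hin
  set B := fderiv ℝ (fderiv ℝ H) 0 with hB
  set b0 := ‖B‖ + M with hb0
  have hM := C.hM
  have hb0' : 0 ≤ b0 := by positivity
  have hr := C.hr
  set C3 := p * 2 ^ (p + 1) * ∫ w : VV N, ks p 1 w with hC3
  have hC30 : 0 ≤ C3 := by
    have : 0 ≤ ∫ w : VV N, ks p 1 w := integral_nonneg fun w => ks_nonneg one_pos w
    positivity
  set C5 := 2 * K + C3 * (2 * M * 2 ^ β) with hC5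
  have ev : ∀ {t : ℝ}, 0 < t → ∀ᶠ s in 𝓝[>] (0:ℝ), s ≤ t := fun ht => by
    filter_upwards [Ioc_mem_nhdsGT ht] with s hs using hs.2
  have evC : ∀ᶠ s in 𝓝[>] (0:ℝ), C5 * s ^ (β - α) < c0 := by
    have h1 : Tendsto (fun s : ℝ => C5 * s ^ (β - α)) (𝓝[>] 0) (𝓝 (C5 * 0)) := by
      apply Tendsto.const_mul
      have := (Real.continuousAt_rpow_const 0 (β - α) (Or.inr (by linarith [hβ.1]))).tendsto
      rw [Real.zero_rpow (by linarith [hβ.1])] at this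
      exact this.mono_left nhdsWithin_le_nhds
    rw [mul_zero] at h1
    exact h1.eventually (gt_mem_nhds hc0)
  have evall := (((((((ev (half_pos hη)).and (ev hs0)).and (ev (by norm_num : (0:ℝ) < 1/2))).and
    (ev (by positivity : 0 < 1/(b0+1)))).and (ev (by positivity : 0 < r/4))).and
    (ev (by positivity : 0 < 1/(4*M+1)))).and evC).and
    (self_mem_nhdsWithin : Set.Ioi (0:ℝ) ∈ 𝓝[>] (0:ℝ))
  obtain ⟨s, ⟨⟨⟨⟨⟨⟨hsη, hss0⟩, hs1⟩, hs2⟩, hs3⟩, hs4⟩, hsC⟩, hs⟩ := evall.exists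
  have hs : 0 < s := hs
  rw [le_div_iff₀ (by positivity)] at hs2 hs4
  obtain ⟨a, ha⟩ : ∃ a, a = s • e := ⟨_, rfl⟩
  have hae : inner ℝ a e = s := by rw [ha, inner_smul_left, inner_ee he]; simp
  have han : ‖a‖ = s := by rw [ha, norm_smul, he, Real.norm_of_nonneg hs.le, mul_one]
  have hna : ‖-a‖ = s := by rw [norm_neg, han]
  have haν : inner ℝ a ν = 0 := by rw [ha, inner_smul_left, real_inner_comm, hνe, mul_zero]
  have hnaν : inner ℝ (-a) ν = 0 := by rw [inner_neg_left, haν, neg_zero]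
  have hH1 : ∀ u : VV N, ‖u‖ = s → |H u| ≤ s := by
    intro u hu
    refine (C.Hbd hβ0 hu.le hs1).trans ?_
    rw [← hB, ← hb0]; nlinarith
  set P := x0 + a + H a • ν with hPd
  set q := x0 + -a + H (-a) • ν with hqd
  have hPF : P ∈ frontier E := C.onF haν (by have := hH1 a han; linarith)
  have hqF : q ∈ frontier E := C.onF hnaν (by have := hH1 _ hna; linarith)
  have hPe : inner ℝ P e - l = s := by
    rw [hPd, inner_add_left, inner_add_left, inner_smul_left, hνe, hx0, hae]
    simp
  have hPx : ‖P - x0‖ ≤ η := by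
    have : P - x0 = a + H a • ν := by rw [hPd]; abel
    rw [this]
    refine (norm_add_le _ _).trans ?_
    rw [norm_smul, C.hν, Real.norm_eq_abs]
    have := hH1 a han
    linarith
  set v := (H (-a) - H a) • ν with hv
  have hqP : ∀ w, q + Rl e w = rf e l (P + (w + v)) := by
    intro w
    have h1 : P + (w + v) = (x0 + a + H (-a) • ν) + w := by rw [hPd, hv]; module
    rw [h1, rf_add, rf_apply he, inner_add_left, inner_add_left, inner_smul_left, hνe, hx0, hae,
      hqd, ha]
    simp; module
  have hvn : ‖v‖ ≤ 2 * M * (2 * s) ^ β * s ^ 2 := by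
    rw [hv, norm_smul, C.hν, mul_one, Real.norm_eq_abs]
    have t1 := C.taylor hβ0 (a := 0) (w := a) (s := s) (by simpa using hs.le) han.le
    have t2 := C.taylor hβ0 (a := 0) (w := -a) (s := s) (by simpa using hs.le) hna.le
    rw [C.d0, zero_add, C.h0, han] at t1
    rw [C.d0, zero_add, C.h0, hna] at t2
    simp only [sub_zero, ContinuousLinearMap.zero_apply, map_neg, ContinuousLinearMap.neg_apply, neg_neg] at t1 t2
    rw [abs_le] at t1 t2 ⊢
    constructor <;> linarith [t1.1, t1.2, t2.1, t2.2]
  have h2s1 : (2 * s) ^ β ≤ 1 := Real.rpow_le_one (by linarith) (by linarith) hβ0.le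
  have hv2 : ‖v‖ ≤ s / 2 := by
    refine hvn.trans ?_
    have : 2 * M * (2 * s) ^ β * s ^ 2 ≤ 2 * M * 1 * s ^ 2 := by gcongr
    nlinarith
  have hsh := ks_shift hNp hs hv2
  rw [← hC3] at hsh
  have hsh2 : C3 * (‖v‖ / s) * s ^ ((N:ℝ) - p) ≤ C3 * (2 * M * 2 ^ β) * s ^ (1 + β - α) := by
    have e1 : s ^ (1 + β - α) = s * s ^ β * s ^ ((N:ℝ) - p) := by
      nth_rewrite 2 [← Real.rpow_one s]
      rw [← Real.rpow_add hs, ← Real.rpow_add hs]; congr 1; rw [hp]; ring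
    have e2 : ‖v‖ / s ≤ 2 * M * 2 ^ β * (s * s ^ β) := by
      rw [div_le_iff₀ hs]
      refine hvn.trans (le_of_eq ?_)
      rw [Real.mul_rpow (by norm_num) hs.le]; ring
    calc _ ≤ C3 * (2 * M * 2 ^ β * (s * s ^ β)) * s ^ ((N:ℝ) - p) := by gcongr
      _ = _ := by rw [e1]; ring
  have hτ : Measurable (tau E) := tau_meas hE.measurableSet
  have hT := tend_diff hα hE hH hPF hqF (Rl e)
  have mf1 : Measurable fun w => tau E (P + w) := hτ.comp (by fun_prop)
  have mf2 : Measurable fun w => tau E (q + Rl e w) := hτ.comp (by fun_prop)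
  have mG : Measurable fun w => tau E (rf e l (P + w)) :=
    hτ.comp ((rf_cont e l).comp (by fun_prop)).measurable
  have hlim := lim_lemma (b := 2 * K * s ^ (1 + β - α)) hNp hs
    (f := fun w => tau E (P + w) - tau E (q + Rl e w)) (mf1.sub mf2)
    (fun w => by
      refine (abs_sub _ _).trans ?_
      rw [tau_abs, tau_abs]; norm_num) hT ?_
  · have hki := ks_integrable (N := N) hNp hs
    have bdi : ∀ {f k : VV N → ℝ}, Integrable k → Measurable f → (∀ w, |f w| = 1) →
        Integrable (fun w => f w * k w) := fun hk hf hb =>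
      hk.bdd_mul (c := 1) hf.aestronglyMeasurable (ae_of_all _ fun w => (hb w).le)
    have i1 := bdi hki mf1 (fun w => tau_abs _ _)
    have i2 := bdi hki mf2 (fun w => tau_abs _ _)
    have iG := bdi hki mG (fun w => tau_abs _ _)
    have hki' : Integrable (fun w => ks p s (w - v)) := hki.comp_sub_right v
    have iG' := bdi hki' mG (fun w => tau_abs _ _)
    have hshift : ∫ w, tau E (q + Rl e w) * ks p s w = ∫ w, tau E (rf e l (P + w)) * ks p s (w - v) := by
      rw [← integral_add_right_eq_self (fun w => tau E (rf e l (P + w)) * ks p s (w - v)) v]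
      simp_rw [hqP]; simp
    have hsplit : ∫ w, (tau E (P + w) - tau E (q + Rl e w)) * ks p s w =
        (∫ w, (tau E (P + w) - tau E (rf e l (P + w))) * ks p s w) +
        ∫ w, tau E (rf e l (P + w)) * (ks p s w - ks p s (w - v)) := by
      simp_rw [sub_mul, mul_sub]
      rw [integral_sub i1 i2, integral_sub i1 iG, integral_sub iG iG', hshift]; ring
    have hsecond : ∫ w, tau E (rf e l (P + w)) * (ks p s w - ks p s (w - v)) ≤
        ∫ w, |ks p s w - ks p s (w - v)| := by
      apply integral_mono (bdi (hki.sub hki') mG (fun w => tau_abs _ _)) (hki.sub hki').abs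
      intro w
      refine (le_abs_self _).trans ?_
      simp [abs_mul, tau_abs]
    have hneg := hmn P s hPx hs (by linarith) (by linarith)
    rw [hPe] at hneg
    have hfin : 0 ≤ C5 * s ^ (1 + β - α) - c0 * s := by
      rw [hC5]
      linarith
    have e3 : s ^ (1 + β - α) = s * s ^ (β - α) := by
      nth_rewrite 2 [← Real.rpow_one s]
      rw [← Real.rpow_add hs]; congr 1; ring
    rw [e3] at hfin
    nlinarith
  · intro ε hε
    have hkd := kd_intOn (N := N) hNp hε hs
    have j1 := hin s hs hss0 a han.le haν (LinearIsometryEquiv.refl ℝ (VV N)) ε hε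
    have j2 := hin s hs hss0 (-a) hna.le hnaν (Rl e) ε hε
    rw [← hPd] at j1
    rw [← hqd] at j2
    simp only [LinearIsometryEquiv.coe_refl, id_eq] at j1
    have hi1 : IntegrableOn (fun w => tau E (P + w) * (‖w‖ ^ (-p) - ks p s w)) {w | ε ≤ ‖w‖} :=
      hkd.bdd_mul (c := 1) mf1.aestronglyMeasurable (ae_of_all _ fun w => by
        rw [Real.norm_eq_abs, tau_abs])
    have hi2 : IntegrableOn (fun w => tau E (q + Rl e w) * (‖w‖ ^ (-p) - ks p s w)) {w | ε ≤ ‖w‖} :=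
      hkd.bdd_mul (c := 1) mf2.aestronglyMeasurable (ae_of_all _ fun w => by
        rw [Real.norm_eq_abs, tau_abs])
    have hsp := integral_sub hi1 hi2
    simp only [← sub_mul] at hsp
    rw [hsp]
    rw [abs_le] at j1 j2
    linarith [j1.2, j2.1]

end


section
variable {N : ℕ} {E : Set (VV N)} {β : ℝ} {x0 ν : VV N} {r M : ℝ} {H : VV N → ℝ}

lemma Chart.reg (C : Chart E β x0 ν r M H) : x0 ∉ interior (closure E) := by
  intro hx
  have hc : Tendsto (fun t : ℝ => x0 + t • ν) (𝓝[>] 0) (𝓝 x0) := by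
    have : Continuous fun t : ℝ => x0 + t • ν := by fun_prop
    have h := this.tendsto 0
    simp only [zero_smul, add_zero] at h
    exact h.mono_left nhdsWithin_le_nhds
  have h1 := hc.eventually (isOpen_interior.mem_nhds hx)
  obtain ⟨t, ht1, ht0, htr⟩ := (h1.and (Ioo_mem_nhdsGT C.hr)).exists
  have hn : ‖t • ν‖ < r := by rw [norm_smul, C.hν, mul_one, Real.norm_of_nonneg ht0.le]; exact htr
  have hH0 : H (t • ν) = 0 := by
    have := C.inv 0 t
    rwa [zero_add, C.h0] at this
  have hi : inner ℝ (t • ν) ν = t := by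
    rw [inner_smul_left, real_inner_self_eq_norm_sq, C.hν]; simp
  have h2 := C.memE _ hn
  have h3 := C.memF _ hn
  rw [hH0, hi] at h2 h3
  have h4 : x0 + t • ν ∈ closure E := interior_subset ht1
  rw [closure_eq_self_union_frontier] at h4
  rcases h4 with h4 | h4
  · linarith [h2.1 h4]
  · linarith [h3.1 h4]

lemma Chart.strict (C : Chart E β x0 ν r M H) {κ : ℝ} (hκ : 0 < κ) :
    ∃ δ > 0, δ ≤ r ∧ ∀ z z' : VV N, ‖z‖ < δ → ‖z'‖ < δ → |H z - H z'| ≤ κ * ‖z - z'‖ := by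
  have h := (C.cd.contDiffAt (x := 0)).hasStrictFDerivAt (by norm_num)
  rw [C.d0] at h
  have h1 := h.isLittleO.def hκ
  simp only [ContinuousLinearMap.zero_apply, sub_zero] at h1
  rw [Metric.eventually_nhds_iff_ball] at h1
  obtain ⟨δ, hδ, hb⟩ := h1
  refine ⟨min δ r, lt_min hδ C.hr, min_le_right _ _, fun z z' hz hz' => ?_⟩
  have := hb (z, z') ?_
  · simpa using this
  · rw [← ball_prod_same]
    exact ⟨by simpa using hz.trans_le (min_le_left _ _), by simpa using hz'.trans_le (min_le_left _ _)⟩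

lemma sym_of_null {e : VV N} (he : ‖e‖ = 1) {l : ℝ} (hE : IsOpen E)
    (hreg : interior (closure E) ⊆ E) (hP : ∀ x ∈ E, l < inner ℝ x e → rf e l x ∈ E)
    (h0 : volume {y : VV N | l < inner ℝ y e ∧ y ∉ E ∧ rf e l y ∈ E} = 0) :
    ∀ x, rf e l x ∈ E → x ∈ E := by
  intro x hx
  rcases lt_trichotomy l (inner ℝ x e) with h | h | h
  · set U : Set (VV N) := {y | l < inner ℝ y e ∧ rf e l y ∈ E} with hU
    have hUo1 : IsOpen {y : VV N | l < inner ℝ y e} :=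
      isOpen_lt continuous_const (continuous_id.inner continuous_const)
    have hUo : IsOpen U := hUo1.inter (hE.preimage (rf_cont e l))
    have hUe : U ∩ (closure E)ᶜ = ∅ := by
      rw [← (hUo.inter isClosed_closure.isOpen_compl).measure_eq_zero_iff volume]
      refine measure_mono_null ?_ h0
      rintro y ⟨⟨h1, h2⟩, h3⟩
      exact ⟨h1, fun h => h3 (subset_closure h), h2⟩
    have hUc : U ⊆ closure E := by
      intro y hy
      by_contra hcon
      have : y ∈ U ∩ (closure E)ᶜ := ⟨hy, hcon⟩
      rw [hUe] at this; exact this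
    exact hreg (interior_maximal hUc hUo ⟨h, hx⟩)
  · have : rf e l x = x := by rw [rf_apply he, ← h]; simp
    rwa [this] at hx
  · have := hP _ hx (by rw [rf_inner he]; linarith)
    rwa [rf_rf he] at this

set_option maxHeartbeats 2000000 in
lemma moving {α c : ℝ} [Nontrivial (VV N)] (hα : α ∈ Set.Ioo (0:ℝ) 1) (hβ : β ∈ Set.Ioo α 1) (hE : IsOpen E)
    (hne : E.Nonempty) (hbd : Bornology.IsBounded E)
    (hch : ∀ x ∈ frontier E, ∃ ν r M H, Chart E β x ν r M H)
    (hH : ∀ x ∈ frontier E, Tendsto (fun ε : ℝ => -∫ y in {y | ε ≤ dist y x},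
          tau E y * dist x y ^ (-((N : ℝ) + α))) (𝓝[>] (0:ℝ)) (𝓝 c))
    {e : VV N} (he : ‖e‖ = 1) :
    ∃ l, (∀ m ≥ l, ∀ x ∈ E, m < inner ℝ x e → rf e m x ∈ E) ∧ (∀ x, rf e l x ∈ E → x ∈ E) := by
  have hreg : interior (closure E) ⊆ E := by
    intro x hx
    by_contra hcon
    have hf : x ∈ frontier E := by
      rw [hE.frontier_eq]; exact ⟨interior_subset hx, hcon⟩
    obtain ⟨ν, r, M, H, C⟩ := hch x hf
    exact C.reg hx
  obtain ⟨R, hR0⟩ := hbd.subset_ball (0 : VV N)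
  have hR : ∀ x ∈ E, |inner ℝ x e| < R := fun x hx => by
    have h1 := hR0 hx
    rw [mem_ball_zero_iff] at h1
    have := abs_real_inner_le_norm x e
    rw [he] at this; linarith
  set S : Set ℝ := {l | ∀ m ≥ l, ∀ x ∈ E, m < inner ℝ x e → rf e m x ∈ E} with hS
  have hRS : R ∈ S := by
    intro m hm x hx hmx
    have := (abs_lt.1 (hR x hx)).2
    have : R ≤ m := hm
    linarith
  have hbb : BddBelow S := by
    refine ⟨-R, fun l hl => ?_⟩
    by_contra hcon
    push Not at hcon
    obtain ⟨x, hx⟩ := hne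
    have h1 := abs_lt.1 (hR x hx)
    have h2 := abs_lt.1 (hR _ (hl l le_rfl x hx (by linarith)))
    rw [rf_inner he] at h2
    linarith [h1.1, h2.1]
  obtain ⟨L, hL⟩ : ∃ L, L = sInf S := ⟨_, rfl⟩
  have hgt : ∀ m > L, ∀ x ∈ E, m < inner ℝ x e → rf e m x ∈ E := by
    intro m hm
    obtain ⟨l', hl', hlm⟩ := exists_lt_of_csInf_lt ⟨R, hRS⟩ (hL ▸ hm)
    exact hl' m hlm.le
  have hPL : ∀ x ∈ E, L < inner ℝ x e → rf e L x ∈ E := by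
    intro x hx hLx
    set V : Set (VV N) := {y | rf e L y ∈ E ∧ L < inner ℝ (rf e L y) e} with hV
    have hVo1 : IsOpen {y : VV N | L < inner ℝ (rf e L y) e} :=
      isOpen_lt continuous_const ((rf_cont e L).inner continuous_const)
    have hVo : IsOpen V := (hE.preimage (rf_cont e L)).inter hVo1
    have hVc : V ⊆ closure E := by
      rintro y ⟨hy1, hy2⟩
      have ht : Tendsto (fun m => rf e m (rf e L y)) (𝓝[>] L) (𝓝 y) := by
        have hc : Continuous fun m : ℝ => rf e m (rf e L y) := by unfold rf; fun_prop
        have := hc.tendsto L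
        rw [rf_rf he] at this
        exact this.mono_left nhdsWithin_le_nhds
      refine mem_closure_of_tendsto ht ?_
      filter_upwards [Ioo_mem_nhdsGT hy2] with m hm
      exact hgt m hm.1 _ hy1 hm.2
    exact hreg (interior_maximal hVc hVo ⟨by rwa [rf_rf he], by rwa [rf_rf he]⟩)
  have hge : ∀ m ≥ L, ∀ x ∈ E, m < inner ℝ x e → rf e m x ∈ E := by
    intro m hm
    rcases eq_or_lt_of_le hm with h | h
    · rw [← h]; exact hPL
    · exact hgt m h
  refine ⟨L, hge, ?_⟩
  apply sym_of_null he hE hreg hPL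
  -- violating sequence
  have hseq : ∀ n : ℕ, ∃ m : ℝ, ∃ x : VV N, L - 1/((n:ℝ)+1) ≤ m ∧ m < L ∧ x ∈ E ∧ m < inner ℝ x e ∧ rf e m x ∉ E := by
    intro n
    have hpos : (0:ℝ) < 1/((n:ℝ)+1) := by positivity
    have hnS : L - 1/((n:ℝ)+1) ∉ S := fun h => by
      have := csInf_le hbb h
      rw [← hL] at this
      linarith
    rw [hS, Set.mem_setOf_eq] at hnS
    push Not at hnS
    obtain ⟨m, hm, x, hx, hmx, hr⟩ := hnS
    refine ⟨m, x, hm, ?_, hx, hmx, hr⟩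
    by_contra hcon
    exact hr (hge m (not_lt.1 hcon) x hx hmx)
  choose m xs hm1 hm2 hxE hmx hrE using hseq
  have hmt : Tendsto m atTop (𝓝 L) := by
    have h1 : Tendsto (fun n : ℕ => L - 1/((n:ℝ)+1)) atTop (𝓝 (L - 0)) :=
      tendsto_one_div_add_atTop_nhds_zero_nat.const_sub L
    rw [sub_zero] at h1
    exact tendsto_of_tendsto_of_tendsto_of_le_of_le h1 tendsto_const_nhds hm1 (fun n => (hm2 n).le)
  obtain ⟨x, hxc, φ, hφ, hxt⟩ := hbd.isCompact_closure.tendsto_subseq (fun n => subset_closure (hxE n))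
  have hmt' : Tendsto (fun n => m (φ n)) atTop (𝓝 L) := hmt.comp hφ.tendsto_atTop
  have hrt : Tendsto (fun n => rf e (m (φ n)) (xs (φ n))) atTop (𝓝 (rf e L x)) := by
    have h1 : Tendsto (fun n => Rl e (xs (φ n))) atTop (𝓝 (Rl e x)) :=
      ((Rl e).continuous.tendsto x).comp hxt
    have h2 : Tendsto (fun n => (2 * m (φ n)) • e) atTop (𝓝 ((2 * L) • e)) :=
      (hmt'.const_mul 2).smul_const e
    simp only [rf]
    exact h1.add h2
  have hrx : rf e L x ∉ E :=
    hE.isClosed_compl.mem_of_tendsto hrt (Eventually.of_forall fun n => hrE _)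
  have hit : Tendsto (fun n => inner ℝ (xs (φ n)) e) atTop (𝓝 (inner ℝ x e)) :=
    ((by fun_prop : Continuous fun y : VV N => inner ℝ y e).tendsto x).comp hxt
  have hLx : L ≤ inner ℝ x e := le_of_tendsto_of_tendsto' hmt' hit (fun n => (hmx _).le)
  rcases eq_or_lt_of_le hLx with h | h
  · have hrxx : rf e L x = x := by rw [rf_apply he, ← h]; simp
    have hxF : x ∈ frontier E := by
      rw [hE.frontier_eq]; exact ⟨hxc, by rwa [hrxx] at hrx⟩
    obtain ⟨ν, r, M, H, C⟩ := hch x hxF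
    refine case2 hα hE hH he hPL hβ C h.symm ?_
    by_contra hνe
    obtain ⟨δ, hδ, hδr, hst⟩ := C.strict (κ := |inner ℝ ν e| / 2) (by positivity)
    rcases lt_or_gt_of_ne hνe with hneg | hpos
    · rw [abs_of_neg hneg] at hst
      obtain ⟨t, ht⟩ : ∃ t, t = δ / 2 := ⟨_, rfl⟩
      have ht0 : 0 < t := by rw [ht]; positivity
      have hn1 : ‖t • e‖ = t := by rw [norm_smul, he, mul_one, Real.norm_of_nonneg ht0.le]
      have hn2 : ‖-(t • e)‖ = t := by rw [norm_neg, hn1]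
      have a1 := hst (t • e) 0 (by rw [hn1, ht]; linarith) (by simpa using hδ)
      have a2 := hst (-(t • e)) 0 (by rw [hn2, ht]; linarith) (by simpa using hδ)
      rw [C.h0, sub_zero, sub_zero, hn1] at a1
      rw [C.h0, sub_zero, sub_zero, hn2] at a2
      have hie : inner ℝ (t • e) ν = t * inner ℝ ν e := by
        rw [inner_smul_left, real_inner_comm]; simp
      have b1 : x + t • e ∈ E := by
        rw [C.memE _ (by rw [hn1, ht]; linarith), hie]
        have := (abs_le.1 a1).1
        nlinarith
      have b2 := hPL _ b1 (by
        rw [inner_add_left, inner_smul_left, inner_ee he, ← h]; simpa using ht0)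
      have b3 : rf e L (x + t • e) = x + -(t • e) := by
        rw [rf_apply he, inner_add_left, inner_smul_left, inner_ee he, ← h]; simp; module
      rw [b3, C.memE _ (by rw [hn2, ht]; linarith), inner_neg_left, hie] at b2
      have := (abs_le.1 a2).2
      nlinarith
    · rw [abs_of_pos hpos] at hst
      rw [hrxx] at hrt
      have e1 := hxt.eventually (Metric.ball_mem_nhds x hδ)
      have e2 := hrt.eventually (Metric.ball_mem_nhds x hδ)
      obtain ⟨n, hn1, hn2⟩ := (e1.and e2).exists
      simp only [Function.comp] at hn1
      obtain ⟨y, hy⟩ : ∃ y, y = xs (φ n) := ⟨_, rfl⟩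
      obtain ⟨mm, hmm⟩ : ∃ mm, mm = m (φ n) := ⟨_, rfl⟩
      rw [← hy] at hn1 hn2
      rw [← hmm] at hn2
      have hd : 0 < inner ℝ y e - mm := by rw [hy, hmm]; linarith [hmx (φ n)]
      obtain ⟨d, hdd⟩ : ∃ d, d = inner ℝ y e - mm := ⟨_, rfl⟩
      rw [← hdd] at hd
      rw [dist_eq_norm] at hn1 hn2
      have hyE := hxE (φ n)
      have hyrE := hrE (φ n)
      rw [← hy] at hyE hyrE
      rw [← hmm] at hyrE
      have c1 := C.memE (y - x) (hn1.trans_le hδr)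
      have c2 := C.memE (rf e mm y - x) (hn2.trans_le hδr)
      rw [add_sub_cancel] at c1 c2
      have c1 := c1.1 hyE
      have c2 := (not_congr c2).1 hyrE
      push Not at c2
      have hdiff : y - x - (rf e mm y - x) = (2 * d) • e := by
        rw [rf_apply he, hdd]; module
      have a := hst _ _ hn1 hn2
      rw [hdiff, norm_smul, he, Real.norm_of_nonneg (by linarith)] at a
      have hin : inner ℝ (y - x) ν - inner ℝ (rf e mm y - x) ν = 2 * d * inner ℝ ν e := by
        rw [← inner_sub_left, hdiff, inner_smul_left, real_inner_comm]; simp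
      have := (abs_le.1 a).2
      nlinarith
  · have hxE' : x ∉ E := fun hx => hrx (hPL x hx h)
    have hxF : x ∈ frontier E := by rw [hE.frontier_eq]; exact ⟨hxc, hxE'⟩
    have hrF : rf e L x ∈ frontier E := by
      rw [hE.frontier_eq]
      refine ⟨?_, hrx⟩
      have h1 : Tendsto (fun n => rf e L (xs (φ n))) atTop (𝓝 (rf e L x)) :=
        ((rf_cont e L).tendsto x).comp hxt
      refine mem_closure_of_tendsto h1 ?_
      filter_upwards [hit.eventually (lt_mem_nhds h)] with n hn
      exact hPL _ (hxE _) hn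
    exact case1 hα hE hH he hPL hxF hrF h
end


lemma bary {N : ℕ} {E : Set (VV N)} (hE : IsOpen E) (hne : E.Nonempty) (hbd : Bornology.IsBounded E)
    {e : VV N} (he : ‖e‖ = 1) {l : ℝ} (hs : ∀ x, rf e l x ∈ E → x ∈ E) :
    inner ℝ ((volume.real E)⁻¹ • ∫ y in E, y) e = l := by
  have hpre : rf e l ⁻¹' E = E := by
    ext x
    exact ⟨hs x, fun h => hs _ (by rwa [rf_rf he])⟩
  have hfin : volume E ≠ ⊤ := hbd.measure_lt_top.ne
  have hpos : 0 < volume.real E := by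
    rw [measureReal_def]
    exact ENNReal.toReal_pos (hE.measure_pos volume hne).ne' hfin
  have hint : IntegrableOn (fun y : VV N => y) E :=
    (continuous_id.continuousOn.integrableOn_compact hbd.isCompact_closure).mono_set subset_closure
  have hint2 : IntegrableOn (fun y : VV N => inner ℝ e y) E := Integrable.const_inner e hint
  have h1 : ∫ y in E, inner ℝ e y = inner ℝ e (∫ y in E, y) := integral_inner hint e
  have h2 := (rf_mp e l).setIntegral_preimage_emb (rf_me he l) (fun y => inner ℝ e y) E
  rw [hpre] at h2
  have h3 : ∀ y, inner ℝ e (rf e l y) = 2 * l - inner ℝ e y := by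
    intro y; rw [real_inner_comm, rf_inner he, real_inner_comm]
  simp_rw [h3] at h2
  have hc : Integrable (fun _ : VV N => 2 * l) (volume.restrict E) := integrableOn_const hfin
  rw [integral_sub hc hint2, setIntegral_const, smul_eq_mul, h1] at h2
  rw [inner_smul_left, real_inner_comm]
  simp only [conj_trivial]
  have h4 : inner ℝ e (∫ y in E, y) = volume.real E * l := by linarith
  rw [h4]; field_simp

theorem alexandrov_constant_nonlocal_mean_curvature
    (N : ℕ) (hN : 2 ≤ N) (α β : ℝ) (hα : α ∈ Set.Ioo (0:ℝ) 1) (hβ : β ∈ Set.Ioo α 1)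
    (E : Set (EuclideanSpace ℝ (Fin N)))
    (hne : E.Nonempty) (hbd : Bornology.IsBounded E) (hop : IsOpen E)
    (hbdry : HasC2HolderBoundary E β) (c : ℝ)
    (hH : ∀ x ∈ frontier E,
      Tendsto (fun ε : ℝ => -∫ y in {y | ε ≤ dist y x},
          tauE E y * dist x y ^ (-((N : ℝ) + α))) (𝓝[>] (0:ℝ)) (𝓝 c)) :
    ∃ (z : EuclideanSpace ℝ (Fin N)) (ρ : ℝ), 0 < ρ ∧ E = Metric.ball z ρ := by
  haveI : Nontrivial (Fin N) := Fin.nontrivial_iff_two_le.2 hN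
  haveI : Nontrivial (VV N) := by infer_instance
  have hβ0 : 0 < β := hα.1.trans hβ.1
  have hmov : ∀ e : VV N, ‖e‖ = 1 → ∃ l, (∀ m ≥ l, ∀ x ∈ E, m < inner ℝ x e → rf e m x ∈ E) ∧
      (∀ x, rf e l x ∈ E → x ∈ E) := fun e he =>
    moving hα hβ hop hne hbd (fun x hx => exists_chart hN hβ0 hbdry hx) hH he
  obtain ⟨z, hz⟩ : ∃ z : VV N, z = (volume.real E)⁻¹ • ∫ y in E, y := ⟨_, rfl⟩
  have key : ∀ x ∈ E, ∀ y : VV N, ‖y - z‖ ≤ ‖x - z‖ → y ∈ E := by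
    intro x hx y hxy
    by_cases hxy' : x = y
    · rwa [← hxy']
    have hd : 0 < ‖x - y‖ := norm_pos_iff.2 (sub_ne_zero.2 hxy')
    obtain ⟨d, hdd⟩ : ∃ d, d = ‖x - y‖ := ⟨_, rfl⟩
    rw [← hdd] at hd
    obtain ⟨e, hee⟩ : ∃ e : VV N, e = d⁻¹ • (x - y) := ⟨_, rfl⟩
    have he : ‖e‖ = 1 := by
      rw [hee, norm_smul, ← hdd, norm_inv, Real.norm_of_nonneg hd.le]; field_simp
    have hxye : x - y = d • e := by rw [hee, smul_smul, mul_inv_cancel₀ hd.ne', one_smul]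
    obtain ⟨l, hl1, hl2⟩ := hmov e he
    have hb := bary hop hne hbd he hl2
    rw [← hz] at hb
    have hxe : inner ℝ x e - inner ℝ y e = d := by
      rw [← inner_sub_left, hxye, inner_smul_left, inner_ee he]; simp
    have hge : l ≤ (inner ℝ x e + inner ℝ y e) / 2 := by
      have h1 : x - z = (y - z) + d • e := by rw [← hxye]; abel
      have h2 : ‖x - z‖ ^ 2 = ‖y - z‖ ^ 2 + 2 * (d * (inner ℝ y e - l)) + d ^ 2 := by
        rw [h1, norm_add_sq_real, inner_smul_right, inner_sub_left, hb, norm_smul, he,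
          Real.norm_of_nonneg hd.le]; ring
      have h3 : ‖y - z‖ ^ 2 ≤ ‖x - z‖ ^ 2 := by gcongr
      have h4 : 0 ≤ d * (2 * (inner ℝ y e - l) + d) := by nlinarith
      have h5 := nonneg_of_mul_nonneg_right h4 hd
      linarith
    have := hl1 _ hge x hx (by linarith)
    rw [rf_apply he] at this
    have e1 : x - (2 * (inner ℝ x e - (inner ℝ x e + inner ℝ y e) / 2)) • e = y := by
      have : 2 * (inner ℝ x e - (inner ℝ x e + inner ℝ y e) / 2) = d := by linarith
      rw [this, ← hxye]; abel
    rwa [e1] at this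
  obtain ⟨x1, hx1⟩ := hne
  set A : Set ℝ := (fun x => ‖x - z‖) '' E with hA
  have hAb : BddAbove A := by
    obtain ⟨R, hR⟩ := hbd.subset_ball z
    refine ⟨R, ?_⟩
    rintro _ ⟨x, hx, rfl⟩
    have := hR hx
    rw [mem_ball_iff_norm] at this
    exact this.le
  have hAne : A.Nonempty := ⟨_, x1, hx1, rfl⟩
  obtain ⟨ρ, hρ⟩ : ∃ ρ, ρ = sSup A := ⟨_, rfl⟩
  -- points of E are strictly inside
  have hlt : ∀ x ∈ E, ‖x - z‖ < ρ := by
    intro x hx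
    obtain ⟨δ, hδ, hb⟩ := Metric.isOpen_iff.1 hop x hx
    obtain ⟨u, hu, hux⟩ : ∃ u : VV N, ‖u‖ = 1 ∧ x - z = ‖x - z‖ • u := by
      by_cases h0 : x - z = 0
      · obtain ⟨u, hu⟩ := exists_norm_eq (VV N) zero_le_one
        exact ⟨u, hu, by rw [h0]; simp⟩
      · have hn : ‖x - z‖ ≠ 0 := norm_ne_zero_iff.2 h0
        refine ⟨‖x - z‖⁻¹ • (x - z), ?_, ?_⟩
        · rw [norm_smul, norm_inv, norm_norm]; field_simp
        · rw [smul_smul, mul_inv_cancel₀ hn, one_smul]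
    have hy : x + (δ/2) • u ∈ E := by
      apply hb
      rw [mem_ball_iff_norm, add_sub_cancel_left, norm_smul, hu, Real.norm_of_nonneg (by linarith)]
      linarith
    have hle : ‖x + (δ/2) • u - z‖ ≤ ρ := by
      rw [hρ]; exact le_csSup hAb ⟨_, hy, rfl⟩
    have e2 : x + (δ/2) • u - z = (‖x - z‖ + δ/2) • u := by
      rw [add_smul, ← hux]; abel
    rw [e2, norm_smul, hu, Real.norm_of_nonneg (by positivity)] at hle
    linarith
  refine ⟨z, ρ, (norm_nonneg _).trans_lt (hlt x1 hx1), ?_⟩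
  ext y
  rw [mem_ball_iff_norm]
  refine ⟨hlt y, fun hy => ?_⟩
  rw [hρ] at hy
  obtain ⟨_, ⟨x, hx, rfl⟩, hlt'⟩ := exists_lt_of_lt_csSup hAne hy
  exact key x hx y hlt'.le
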